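/- arXiv:0711.0173 — 2 statements merged into one kernel-verified Lean document; each statement's English description precedes it below -/
import Mathlib

section
/- Let Ω be the Koch snowflake domain and D = log 4 / log 3. Then there exist ε₀ > 0 and bounded functions G₁, G₂ : (0,∞) → ℝ satisfying G_i(3ε) = G_i(ε) for all ε > 0 (i = 1,2), such that for every ε with 0 < ε ≤ ε₀, the area (2-dimensional Lebesgue measure) of {x ∈ Ω : dist(x, ∂Ω) ≤ ε} equals G₁(ε) ε^{2−D} + G₂(ε) ε². -/
open MeasureTheory Metric

namespace KochTube
noncomputable section

/-- Rescaled second coordinate. -/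
def Yc (z : ℂ) : ℝ := Real.sqrt 3 * z.im
/-- Point from its coordinates. -/
def co (x Y : ℝ) : ℂ := ⟨x, Y / Real.sqrt 3⟩

lemma s3pos : 0 < Real.sqrt 3 := by positivity
lemma s3sq : Real.sqrt 3 * Real.sqrt 3 = 3 := Real.mul_self_sqrt (by norm_num)

@[simp] lemma co_re (x Y : ℝ) : (co x Y).re = x := rfl
@[simp] lemma Yc_co (x Y : ℝ) : Yc (co x Y) = Y := by
  have := s3pos
  simp only [Yc, co]; field_simp

lemma ext_co {z w : ℂ} (h1 : z.re = w.re) (h2 : Yc z = Yc w) : z = w := by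
  apply Complex.ext h1
  exact mul_left_cancel₀ s3pos.ne' h2

lemma dist_sq (z w : ℂ) : dist z w ^ 2 = (z.re - w.re) ^ 2 + (Yc z - Yc w) ^ 2 / 3 := by
  rw [Complex.dist_eq_re_im, Real.sq_sqrt (by positivity)]
  have h : (Yc z - Yc w) ^ 2 = 3 * (z.im - w.im) ^ 2 := by
    simp only [Yc]
    linear_combination (z.im - w.im) ^ 2 * s3sq
  rw [h]; ring

lemma dist_le_of {z w : ℂ} {ε : ℝ} (h0 : 0 ≤ ε)
    (h : (z.re - w.re) ^ 2 + (Yc z - Yc w) ^ 2 / 3 ≤ ε ^ 2) : dist z w ≤ ε := by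
  rw [← dist_sq] at h
  exact le_trans (le_abs_self _) (abs_le_of_sq_le_sq h h0)

/-- Affine self-equivalences in coordinates. -/
def p1 : ℂ ≃ ℂ where
  toFun z := co (z.re / 2 + Yc z / 6) (z.re / 2 - Yc z / 2)
  invFun z := co ((3 * z.re + Yc z) / 2) (3 * (z.re - Yc z) / 2)
  left_inv z := by apply ext_co <;> simp <;> ring
  right_inv z := by apply ext_co <;> simp <;> ring

def p2 : ℂ ≃ ℂ where
  toFun z := co (1 / 2 + z.re / 2 - Yc z / 6) ((1 - z.re) / 2 - Yc z / 2)
  invFun z := co (1 - (3 * (1 - z.re) + Yc z) / 2) (3 * (1 - z.re - Yc z) / 2)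
  left_inv z := by apply ext_co <;> simp <;> ring
  right_inv z := by apply ext_co <;> simp <;> ring

def sg : ℂ ≃ ℂ where
  toFun z := co (1 - z.re) (Yc z)
  invFun z := co (1 - z.re) (Yc z)
  left_inv z := by apply ext_co <;> simp
  right_inv z := by apply ext_co <;> simp

def rh : ℂ ≃ ℂ where
  toFun z := co (1 / 2 - (z.re + Yc z) / 2) ((3 * z.re - Yc z) / 2 - 3 / 2)
  invFun z := co (1 / 2 - 1 / 2 * (z.re - 1 / 2) + (Yc z + 1 / 2) / 2)
    (-(3 * (z.re - 1 / 2)) / 2 - (Yc z + 1 / 2) / 2 - 1 / 2)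
  left_inv z := by apply ext_co <;> simp <;> ring
  right_inv z := by apply ext_co <;> simp <;> ring

/-- Contraction by `1/3` towards `ξ`. -/
def ch : ℂ ≃ ℂ where
  toFun z := co (1 / 2 + (z.re - 1 / 2) / 3) (1 / 2 + (Yc z - 1 / 2) / 3)
  invFun z := co (1 / 2 + (z.re - 1 / 2) * 3) (1 / 2 + (Yc z - 1 / 2) * 3)
  left_inv z := by apply ext_co <;> simp
  right_inv z := by apply ext_co <;> simp

lemma p1_re (z : ℂ) : (p1 z).re = z.re / 2 + Yc z / 6 := rfl
lemma p1_Y (z : ℂ) : Yc (p1 z) = z.re / 2 - Yc z / 2 := Yc_co _ _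
lemma p1i_re (z : ℂ) : (p1.symm z).re = (3 * z.re + Yc z) / 2 := rfl
lemma p1i_Y (z : ℂ) : Yc (p1.symm z) = 3 * (z.re - Yc z) / 2 := Yc_co _ _
lemma p2_re (z : ℂ) : (p2 z).re = 1 / 2 + z.re / 2 - Yc z / 6 := rfl
lemma p2_Y (z : ℂ) : Yc (p2 z) = (1 - z.re) / 2 - Yc z / 2 := Yc_co _ _
lemma p2i_re (z : ℂ) : (p2.symm z).re = 1 - (3 * (1 - z.re) + Yc z) / 2 := rfl
lemma p2i_Y (z : ℂ) : Yc (p2.symm z) = 3 * (1 - z.re - Yc z) / 2 := Yc_co _ _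
lemma sg_re (z : ℂ) : (sg z).re = 1 - z.re := rfl
lemma sg_Y (z : ℂ) : Yc (sg z) = Yc z := Yc_co _ _
lemma rh_re (z : ℂ) : (rh z).re = 1 / 2 - (z.re + Yc z) / 2 := rfl
lemma rh_Y (z : ℂ) : Yc (rh z) = (3 * z.re - Yc z) / 2 - 3 / 2 := Yc_co _ _
lemma ch_re (z : ℂ) : (ch z).re = 1 / 2 + (z.re - 1 / 2) / 3 := rfl
lemma ch_Y (z : ℂ) : Yc (ch z) = 1 / 2 + (Yc z - 1 / 2) / 3 := Yc_co _ _
lemma chi_re (z : ℂ) : (ch.symm z).re = 1 / 2 + (z.re - 1 / 2) * 3 := rfl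
lemma chi_Y (z : ℂ) : Yc (ch.symm z) = 1 / 2 + (Yc z - 1 / 2) * 3 := Yc_co _ _

lemma sg_sg (z : ℂ) : sg (sg z) = z := sg.left_inv z
lemma sg_p1 (z : ℂ) : sg (p1 z) = p2 (sg z) := by
  apply ext_co <;> simp only [sg_re, sg_Y, p1_re, p1_Y, p2_re, p2_Y] <;> ring
lemma sg_p2 (z : ℂ) : sg (p2 z) = p1 (sg z) := by
  apply ext_co <;> simp only [sg_re, sg_Y, p1_re, p1_Y, p2_re, p2_Y] <;> ring
lemma rh3 (z : ℂ) : rh (rh (rh z)) = z := by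
  apply ext_co <;> simp only [rh_re, rh_Y] <;> ring
lemma ch_p1 (z : ℂ) : ch (p1 z) = p1 (p2 (p2 z)) := by
  apply ext_co <;> simp only [ch_re, ch_Y, p1_re, p1_Y, p2_re, p2_Y] <;> ring

lemma dist_of_sq {a b : ℝ} (ha : 0 ≤ a) (hb : 0 ≤ b) (h : a ^ 2 = b ^ 2) : a = b :=
  (sq_eq_sq₀ ha hb).1 h

lemma dist_p1 (z w : ℂ) : Real.sqrt 3 * dist (p1 z) (p1 w) = dist z w := by
  apply dist_of_sq (by positivity) (by positivity)
  rw [mul_pow, dist_sq, dist_sq, Real.sq_sqrt (by norm_num), p1_re, p1_re, p1_Y, p1_Y]; ring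
lemma dist_p2 (z w : ℂ) : Real.sqrt 3 * dist (p2 z) (p2 w) = dist z w := by
  apply dist_of_sq (by positivity) (by positivity)
  rw [mul_pow, dist_sq, dist_sq, Real.sq_sqrt (by norm_num), p2_re, p2_re, p2_Y, p2_Y]; ring
lemma dist_sg (z w : ℂ) : dist (sg z) (sg w) = dist z w := by
  apply dist_of_sq (by positivity) (by positivity)
  rw [dist_sq, dist_sq, sg_re, sg_re, sg_Y, sg_Y]; ring
lemma dist_rh (z w : ℂ) : dist (rh z) (rh w) = dist z w := by
  apply dist_of_sq (by positivity) (by positivity)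
  rw [dist_sq, dist_sq, rh_re, rh_re, rh_Y, rh_Y]; ring
lemma dist_ch (z w : ℂ) : 3 * dist (ch z) (ch w) = dist z w := by
  apply dist_of_sq (by positivity) (by positivity)
  rw [mul_pow, dist_sq, dist_sq, ch_re, ch_re, ch_Y, ch_Y]; ring

lemma cont_Yc : Continuous Yc := continuous_const.mul Complex.continuous_im
lemma cont_co {f g : ℂ → ℝ} (hf : Continuous f) (hg : Continuous g) :
    Continuous fun z => co (f z) (g z) := by
  have : (fun z => co (f z) (g z)) = fun z => (f z : ℂ) + (g z / Real.sqrt 3 : ℝ) * Complex.I := by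
    funext z; apply Complex.ext <;> simp [co]
  rw [this]
  fun_prop

lemma cont_p1 : Continuous p1 := by
  have := cont_Yc; have := Complex.continuous_re
  exact cont_co (by fun_prop) (by fun_prop)
lemma cont_p1i : Continuous p1.symm := by
  have := cont_Yc; have := Complex.continuous_re
  exact cont_co (by fun_prop) (by fun_prop)
lemma cont_p2 : Continuous p2 := by
  have := cont_Yc; have := Complex.continuous_re
  exact cont_co (by fun_prop) (by fun_prop)
lemma cont_p2i : Continuous p2.symm := by
  have := cont_Yc; have := Complex.continuous_re
  exact cont_co (by fun_prop) (by fun_prop)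
lemma cont_sg : Continuous sg := by
  have := cont_Yc; have := Complex.continuous_re
  exact cont_co (by fun_prop) (by fun_prop)
lemma cont_rh : Continuous rh := by
  have := cont_Yc; have := Complex.continuous_re
  exact cont_co (by fun_prop) (by fun_prop)

lemma open_p1 {A : Set ℂ} (h : IsOpen A) : IsOpen (p1 '' A) := by
  rw [Equiv.image_eq_preimage_symm]; exact h.preimage cont_p1i
lemma open_p2 {A : Set ℂ} (h : IsOpen A) : IsOpen (p2 '' A) := by
  rw [Equiv.image_eq_preimage_symm]; exact h.preimage cont_p2i

/-! Volumes of images. -/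
lemma vol_aff (e : ℂ → ℂ) (a b c d p q : ℝ)
    (he : ∀ z, e z = co (a * z.re + b * Yc z + p) (c * z.re + d * Yc z + q)) (A : Set ℂ) :
    volume.real (e '' A) = |a * d - b * c| * volume.real A := by
  have s3 := s3pos
  let M : Matrix (Fin 2) (Fin 2) ℝ := !![a, b * Real.sqrt 3; c / Real.sqrt 3, d]
  let L : ℂ →ₗ[ℝ] ℂ := Matrix.toLin Complex.basisOneI Complex.basisOneI M
  have hdet : LinearMap.det L = a * d - b * c := by
    rw [LinearMap.det_toLin]
    simp only [M, Matrix.det_fin_two_of]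
    field_simp
  have hL : ∀ z, e z = co p q + L z := by
    intro z
    rw [he]
    simp only [L, Matrix.toLin_apply, M]
    apply Complex.ext
    · simp [Fin.sum_univ_two, Matrix.mulVec, dotProduct, Yc, co]; ring
    · simp [Fin.sum_univ_two, Matrix.mulVec, dotProduct, Yc, co]; field_simp; ring
  have himg : e '' A = (fun z => co p q + z) '' (L '' A) := by
    rw [Set.image_image]; exact Set.image_congr fun z _ => hL z
  rw [himg, Measure.real, Measure.real, Set.image_add_left, measure_preimage_add,
    Measure.addHaar_image_linearMap, hdet, ENNReal.toReal_mul, ENNReal.toReal_ofReal (abs_nonneg _)]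

lemma vol_p1 (A : Set ℂ) : volume.real (p1 '' A) = 1 / 3 * volume.real A := by
  rw [vol_aff p1 (1/2) (1/6) (1/2) (-1/2) 0 0 _ A]
  · norm_num
  · intro z; apply ext_co
    · rw [p1_re, co_re]; ring
    · rw [p1_Y, Yc_co]; ring
lemma vol_sg (A : Set ℂ) : volume.real (sg '' A) = volume.real A := by
  rw [vol_aff sg (-1) 0 0 1 1 0 _ A]
  · norm_num
  · intro z; apply ext_co
    · rw [sg_re, co_re]; ring
    · rw [sg_Y, Yc_co]; ring
lemma vol_rh (A : Set ℂ) : volume.real (rh '' A) = volume.real A := by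
  rw [vol_aff rh (-1/2) (-1/2) (3/2) (-1/2) (1/2) (-3/2) _ A]
  · norm_num
  · intro z; apply ext_co
    · rw [rh_re, co_re]; ring
    · rw [rh_Y, Yc_co]; ring
lemma vol_ch (A : Set ℂ) : volume.real (ch '' A) = 1 / 9 * volume.real A := by
  rw [vol_aff ch (1/3) 0 0 (1/3) (1/3) (1/3) _ A]
  · norm_num
  · intro z; apply ext_co
    · rw [ch_re, co_re]; ring
    · rw [ch_Y, Yc_co]; ring

/-- Lines have measure zero. -/
lemma line_null (a b d : ℝ) (h : a ≠ 0 ∨ b ≠ 0) :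
    volume {z : ℂ | a * z.re + b * Yc z = d} = 0 := by
  let f : ℂ →ₗ[ℝ] ℝ := a • Complex.reLm + (b * Real.sqrt 3) • Complex.imLm
  have hf : ∀ z, f z = a * z.re + b * Yc z := by
    intro z; simp [f, Yc]; ring
  rcases Set.eq_empty_or_nonempty {z : ℂ | a * z.re + b * Yc z = d} with h0 | ⟨z0, hz0⟩
  · rw [h0]; exact measure_empty
  · have hk : LinearMap.ker f ≠ ⊤ := by
      intro ht
      have h0 : ∀ z, f z = 0 := fun z => by
        have : z ∈ LinearMap.ker f := by rw [ht]; trivial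
        exact this
      rcases h with h | h
      · have := h0 (co 1 0); rw [hf] at this; simp at this; exact h this
      · have := h0 (co 0 1); rw [hf] at this; simp at this; exact h this
    have h1 := Measure.addHaar_submodule (volume : Measure ℂ) (LinearMap.ker f) hk
    have : {z : ℂ | a * z.re + b * Yc z = d} = (fun z => -z0 + z) ⁻¹' (LinearMap.ker f : Set ℂ) := by
      ext z
      have hz0' : f z0 = d := by rw [hf]; exact hz0
      simp only [Set.mem_ofPred_eq, Set.mem_preimage, SetLike.mem_coe, LinearMap.mem_ker, map_add,
        map_neg, hz0', ← hf]
      constructor <;> intro h <;> linarith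
    rw [this, measure_preimage_add, h1]

/-! The sets. -/
def T : Set ℂ := {z | 0 ≤ Yc z ∧ Yc z ≤ z.re ∧ Yc z ≤ 1 - z.re}
def R : Set ℂ := {z | 0 < z.re + Yc z ∧ 0 < 1 - z.re + Yc z ∧ 3 * z.re + Yc z < 3 ∧ Yc z < 3 * z.re}
def M : Set ℂ := {z | 0 < z.re + Yc z ∧ 0 < 1 - z.re + Yc z ∧
  (Yc z < 0 ∨ (Yc z < 3 * z.re - 1 ∧ Yc z < 2 - 3 * z.re))}
def De : Set ℂ := {z | Yc z < 0 ∧ 0 < 3 * z.re + Yc z ∧ 0 < 3 * (1 - z.re) + Yc z}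
def Uu : ℕ → Set ℂ
  | 0 => M
  | n + 1 => M ∪ (p1 '' (p1 '' Uu n ∪ p2 '' Uu n) ∪ p2 '' (p1 '' Uu n ∪ p2 '' Uu n))
def In : Set ℂ := ⋃ n, Uu n
def Out : Set ℂ := p1 '' In ∪ p2 '' In

lemma M_sub_Uu (n : ℕ) : M ⊆ Uu n := by
  cases n with
  | zero => exact le_rfl
  | succ n => exact Set.subset_union_left

lemma M_sub_In : M ⊆ In := (M_sub_Uu 0).trans (Set.subset_iUnion Uu 0)

lemma In_eq : In = M ∪ (p1 '' Out ∪ p2 '' Out) := by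
  have h : Out = ⋃ n, (p1 '' Uu n ∪ p2 '' Uu n) := by
    simp only [Out, In, Set.image_iUnion, Set.iUnion_union_distrib]
  apply Set.Subset.antisymm
  · apply Set.iUnion_subset
    intro n
    cases n with
    | zero => exact Set.subset_union_left
    | succ n =>
      have : p1 '' Uu n ∪ p2 '' Uu n ⊆ Out := by
        rw [h]; exact Set.subset_iUnion (fun n => p1 '' Uu n ∪ p2 '' Uu n) n
      exact Set.union_subset_union_right _
        (Set.union_subset_union (Set.image_mono this) (Set.image_mono this))
  · apply Set.union_subset M_sub_In
    rw [h, Set.image_iUnion, Set.image_iUnion, ← Set.iUnion_union_distrib]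
    apply Set.iUnion_subset
    intro n
    exact Set.Subset.trans Set.subset_union_right (Set.subset_iUnion Uu (n + 1))

lemma p1Out_sub : p1 '' Out ⊆ In := by
  rw [In_eq]; exact fun z hz => Or.inr (Or.inl hz)
lemma p2Out_sub : p2 '' Out ⊆ In := by
  rw [In_eq]; exact fun z hz => Or.inr (Or.inr hz)

/-- Induction principle for `In`. -/
lemma In_ind (P : ℂ → Prop) (hM : ∀ z ∈ M, P z)
    (h11 : ∀ z, P z → P (p1 (p1 z))) (h12 : ∀ z, P z → P (p1 (p2 z)))
    (h21 : ∀ z, P z → P (p2 (p1 z))) (h22 : ∀ z, P z → P (p2 (p2 z))) : ∀ z ∈ In, P z := by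
  have : ∀ n, ∀ z ∈ Uu n, P z := by
    intro n
    induction n with
    | zero => exact hM
    | succ n ih =>
      rintro z (h | ⟨w, ⟨v, hv, rfl⟩ | ⟨v, hv, rfl⟩, rfl⟩ | ⟨w, ⟨v, hv, rfl⟩ | ⟨v, hv, rfl⟩, rfl⟩)
      · exact hM z h
      · exact h11 _ (ih _ hv)
      · exact h12 _ (ih _ hv)
      · exact h21 _ (ih _ hv)
      · exact h22 _ (ih _ hv)
  intro z hz
  obtain ⟨n, hn⟩ := Set.mem_iUnion.1 hz
  exact this n z hn

lemma In_11 {z : ℂ} (h : z ∈ In) : p1 (p1 z) ∈ In :=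
  p1Out_sub ⟨_, Or.inl ⟨z, h, rfl⟩, rfl⟩
lemma In_12 {z : ℂ} (h : z ∈ In) : p1 (p2 z) ∈ In :=
  p1Out_sub ⟨_, Or.inr ⟨z, h, rfl⟩, rfl⟩
lemma In_21 {z : ℂ} (h : z ∈ In) : p2 (p1 z) ∈ In :=
  p2Out_sub ⟨_, Or.inl ⟨z, h, rfl⟩, rfl⟩
lemma In_22 {z : ℂ} (h : z ∈ In) : p2 (p2 z) ∈ In :=
  p2Out_sub ⟨_, Or.inr ⟨z, h, rfl⟩, rfl⟩

lemma M_sub_R {z : ℂ} (h : z ∈ M) : z ∈ R := by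
  obtain ⟨h1, h2, h3 | ⟨h3, h4⟩⟩ := h <;> refine ⟨h1, h2, ?_, ?_⟩ <;> linarith
lemma p1_R {z : ℂ} (h : z ∈ R) : p1 z ∈ R := by
  obtain ⟨h1, h2, h3, h4⟩ := h
  refine ⟨?_, ?_, ?_, ?_⟩ <;> rw [p1_re, p1_Y] <;> linarith
lemma p2_R {z : ℂ} (h : z ∈ R) : p2 z ∈ R := by
  obtain ⟨h1, h2, h3, h4⟩ := h
  refine ⟨?_, ?_, ?_, ?_⟩ <;> rw [p2_re, p2_Y] <;> linarith
lemma p1_R_re {z : ℂ} (h : z ∈ R) : (p1 z).re < 1 / 2 := by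
  obtain ⟨h1, h2, h3, h4⟩ := h
  rw [p1_re]; linarith
lemma p2_R_re {z : ℂ} (h : z ∈ R) : 1 / 2 < (p2 z).re := by
  obtain ⟨h1, h2, h3, h4⟩ := h
  rw [p2_re]; linarith
lemma p1_R_Y {z : ℂ} (h : z ∈ R) : Yc (p1 z) < 1 / 2 := by
  obtain ⟨h1, h2, h3, h4⟩ := h
  rw [p1_Y]; linarith

lemma In_sub_R : ∀ z ∈ In, z ∈ R :=
  In_ind _ (fun _ => M_sub_R) (fun _ h => p1_R (p1_R h)) (fun _ h => p1_R (p2_R h))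
    (fun _ h => p2_R (p1_R h)) (fun _ h => p2_R (p2_R h))
lemma Out_sub_R : ∀ z ∈ Out, z ∈ R := by
  rintro z (⟨w, hw, rfl⟩ | ⟨w, hw, rfl⟩)
  · exact p1_R (In_sub_R w hw)
  · exact p2_R (In_sub_R w hw)

lemma M_sg {z : ℂ} (h : z ∈ M) : sg z ∈ M := by
  obtain ⟨h1, h2, h3⟩ := h
  refine ⟨?_, ?_, ?_⟩ <;> rw [sg_re, sg_Y]
  · linarith
  · linarith
  · rcases h3 with h3 | ⟨h3, h4⟩
    · exact Or.inl h3
    · right; constructor <;> linarith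
lemma In_sg : ∀ z ∈ In, sg z ∈ In := by
  apply In_ind
  · exact fun z h => M_sub_In (M_sg h)
  · intro z h; rw [sg_p1, sg_p1]; exact In_22 h
  · intro z h; rw [sg_p1, sg_p2]; exact In_21 h
  · intro z h; rw [sg_p2, sg_p1]; exact In_12 h
  · intro z h; rw [sg_p2, sg_p2]; exact In_11 h

lemma open_M : IsOpen M := by
  have h1 := cont_Yc; have h2 := Complex.continuous_re
  unfold M
  exact IsOpen.inter (s := {z : ℂ | 0 < z.re + Yc z}) (isOpen_lt (by fun_prop) (by fun_prop))
    (IsOpen.inter (s := {z : ℂ | 0 < 1 - z.re + Yc z}) (isOpen_lt (by fun_prop) (by fun_prop))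
    (IsOpen.union (s₁ := {z : ℂ | Yc z < 0}) (isOpen_lt (by fun_prop) (by fun_prop))
    (IsOpen.inter (s := {z : ℂ | Yc z < 3 * z.re - 1}) (t := {z : ℂ | Yc z < 2 - 3 * z.re})
      (isOpen_lt (by fun_prop) (by fun_prop)) (isOpen_lt (by fun_prop) (by fun_prop)))))
lemma open_In : IsOpen In := by
  apply isOpen_iUnion
  intro n
  induction n with
  | zero => exact open_M
  | succ n ih =>
    have := (open_p1 ih).union (open_p2 ih)
    exact open_M.union ((open_p1 this).union (open_p2 this))
lemma open_Out : IsOpen Out := (open_p1 open_In).union (open_p2 open_In)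

/-! Convexity and connectedness. -/
lemma lin_Yc : IsLinearMap ℝ Yc :=
  ⟨fun x y => by simp [Yc]; ring, fun a x => by simp [Yc]; ring⟩

lemma convex_lt (a b d : ℝ) : Convex ℝ {z : ℂ | a * z.re + b * Yc z < d} := by
  apply convex_halfSpace_lt
  constructor
  · intro x y; rw [lin_Yc.map_add]; simp; ring
  · intro t x; rw [lin_Yc.map_smul]; simp; ring

lemma preconn_lt (a b d : ℝ) : IsPreconnected {z : ℂ | a * z.re + b * Yc z < d} :=
  (convex_lt a b d).isPreconnected

lemma preconn_De : IsPreconnected De := by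
  have : De = {z : ℂ | 0 * z.re + 1 * Yc z < 0} ∩ ({z : ℂ | (-3) * z.re + (-1) * Yc z < 0} ∩
      {z : ℂ | 3 * z.re + (-1) * Yc z < 3}) := by
    ext z
    simp only [De, Set.mem_ofPred_eq, Set.mem_inter_iff]
    constructor
    · rintro ⟨h1, h2, h3⟩; refine ⟨?_, ?_, ?_⟩ <;> linarith
    · rintro ⟨h1, h2, h3⟩; refine ⟨?_, ?_, ?_⟩ <;> linarith
  rw [this]
  exact ((convex_lt _ _ _).inter ((convex_lt _ _ _).inter (convex_lt _ _ _))).isPreconnected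

def m0 : ℂ := co (1 / 2) (-1 / 4)
lemma m0_M : m0 ∈ M := by
  refine ⟨?_, ?_, Or.inl ?_⟩ <;> norm_num [m0]
lemma m0_In : m0 ∈ In := M_sub_In m0_M
lemma m0_De : m0 ∈ De := by
  refine ⟨?_, ?_, ?_⟩ <;> norm_num [m0]

lemma preconn_M : IsPreconnected M := by
  have : M = ({z : ℂ | (-1) * z.re + (-1) * Yc z < 0} ∩ ({z : ℂ | 1 * z.re + (-1) * Yc z < 1} ∩
      {z : ℂ | 0 * z.re + 1 * Yc z < 0})) ∪
      ({z : ℂ | (-1) * z.re + (-1) * Yc z < 0} ∩ ({z : ℂ | 1 * z.re + (-1) * Yc z < 1} ∩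
      ({z : ℂ | (-3) * z.re + 1 * Yc z < -1} ∩ {z : ℂ | 3 * z.re + 1 * Yc z < 2}))) := by
    ext z
    simp only [M, Set.mem_ofPred_eq, Set.mem_inter_iff, Set.mem_union]
    constructor
    · rintro ⟨h1, h2, h3 | ⟨h3, h4⟩⟩
      · left; refine ⟨?_, ?_, ?_⟩ <;> linarith
      · right; refine ⟨?_, ?_, ?_, ?_⟩ <;> linarith
    · rintro (⟨h1, h2, h3⟩ | ⟨h1, h2, h3, h4⟩)
      · refine ⟨?_, ?_, Or.inl ?_⟩ <;> linarith
      · refine ⟨?_, ?_, Or.inr ⟨?_, ?_⟩⟩ <;> linarith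
  rw [this]
  refine IsPreconnected.union m0 ?_ ?_ ?_ ?_
  · refine ⟨?_, ?_, ?_⟩ <;> norm_num [m0]
  · refine ⟨?_, ?_, ?_, ?_⟩ <;> norm_num [m0]
  · exact ((convex_lt _ _ _).inter ((convex_lt _ _ _).inter (convex_lt _ _ _))).isPreconnected
  · exact ((convex_lt _ _ _).inter ((convex_lt _ _ _).inter
      ((convex_lt _ _ _).inter (convex_lt _ _ _)))).isPreconnected

lemma m0_12 : p1 (p2 m0) ∈ M := by
  refine ⟨?_, ?_, Or.inr ⟨?_, ?_⟩⟩ <;> simp only [p1_re, p1_Y, p2_re, p2_Y] <;> norm_num [m0]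
lemma m0_11 : p1 (p1 m0) ∈ M := by
  refine ⟨?_, ?_, Or.inl ?_⟩ <;> simp only [p1_re, p1_Y, p2_re, p2_Y] <;> norm_num [m0]
lemma m0_21 : p2 (p1 m0) ∈ M := by
  refine ⟨?_, ?_, Or.inr ⟨?_, ?_⟩⟩ <;> simp only [p1_re, p1_Y, p2_re, p2_Y] <;> norm_num [m0]
lemma m0_22 : p2 (p2 m0) ∈ M := by
  refine ⟨?_, ?_, Or.inl ?_⟩ <;> simp only [p1_re, p1_Y, p2_re, p2_Y] <;> norm_num [m0]

lemma preconn_Uu (n : ℕ) : IsPreconnected (Uu n) := by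
  induction n with
  | zero => exact preconn_M
  | succ n ih =>
    have hm : m0 ∈ Uu n := M_sub_Uu n m0_M
    have c1 : IsPreconnected (p1 '' Uu n) := ih.image _ cont_p1.continuousOn
    have c2 : IsPreconnected (p2 '' Uu n) := ih.image _ cont_p2.continuousOn
    have c11 := c1.image _ cont_p1.continuousOn
    have c12 := c2.image _ cont_p1.continuousOn
    have c21 := c1.image _ cont_p2.continuousOn
    have c22 := c2.image _ cont_p2.continuousOn
    have e : Uu (n + 1) = ((M ∪ p1 '' (p1 '' Uu n)) ∪ (M ∪ p1 '' (p2 '' Uu n))) ∪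
       ((M ∪ p2 '' (p1 '' Uu n)) ∪ (M ∪ p2 '' (p2 '' Uu n))) := by
      show M ∪ (p1 '' (p1 '' Uu n ∪ p2 '' Uu n) ∪ p2 '' (p1 '' Uu n ∪ p2 '' Uu n)) = _
      rw [Set.image_union, Set.image_union]
      ext z; simp only [Set.mem_union]; tauto
    rw [e]
    refine IsPreconnected.union m0 (Or.inl (Or.inl m0_M)) (Or.inl (Or.inl m0_M)) ?_ ?_
    · refine IsPreconnected.union m0 (Or.inl m0_M) (Or.inl m0_M) ?_ ?_
      · exact IsPreconnected.union _ m0_11 ⟨_, ⟨_, hm, rfl⟩, rfl⟩ preconn_M c11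
      · exact IsPreconnected.union _ m0_12 ⟨_, ⟨_, hm, rfl⟩, rfl⟩ preconn_M c12
    · refine IsPreconnected.union m0 (Or.inl m0_M) (Or.inl m0_M) ?_ ?_
      · exact IsPreconnected.union _ m0_21 ⟨_, ⟨_, hm, rfl⟩, rfl⟩ preconn_M c21
      · exact IsPreconnected.union _ m0_22 ⟨_, ⟨_, hm, rfl⟩, rfl⟩ preconn_M c22

lemma preconn_In : IsPreconnected In := by
  apply isPreconnected_iUnion
  · exact ⟨m0, Set.mem_iInter.2 fun n => M_sub_Uu n m0_M⟩
  · exact preconn_Uu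

/-! Boundedness. -/
lemma bdd_of {A : Set ℂ} (C : ℝ) (h : ∀ z ∈ A, |z.re| ≤ C ∧ |Yc z| ≤ C) : Bornology.IsBounded A := by
  rw [isBounded_iff_subset_closedBall 0]
  refine ⟨2 * |C|, fun z hz => ?_⟩
  obtain ⟨h1, h2⟩ := h z hz
  have h1' := sq_le_sq' (abs_le.1 h1).1 (abs_le.1 h1).2
  have h2' := sq_le_sq' (abs_le.1 h2).1 (abs_le.1 h2).2
  rw [mem_closedBall]
  apply dist_le_of (by positivity)
  have : Yc 0 = 0 := by simp [Yc]
  rw [this, mul_pow, sq_abs]; simp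
  nlinarith [sq_nonneg C]

lemma bdd_T : Bornology.IsBounded T := by
  apply bdd_of 1
  rintro z ⟨h1, h2, h3⟩
  constructor <;> rw [abs_le] <;> constructor <;> linarith
lemma bdd_R : Bornology.IsBounded R := by
  apply bdd_of 3
  rintro z ⟨h1, h2, h3, h4⟩
  constructor <;> rw [abs_le] <;> constructor <;> linarith

lemma closed_T : IsClosed T := by
  have h1 := cont_Yc; have h2 := Complex.continuous_re
  unfold T
  exact IsClosed.inter (s₁ := {z : ℂ | 0 ≤ Yc z}) (isClosed_le (by fun_prop) (by fun_prop))
    (IsClosed.inter (s₁ := {z : ℂ | Yc z ≤ z.re}) (s₂ := {z : ℂ | Yc z ≤ 1 - z.re})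
    (isClosed_le (by fun_prop) (by fun_prop)) (isClosed_le (by fun_prop) (by fun_prop)))

lemma p1_T {z : ℂ} (h : z ∈ T) : p1 z ∈ T := by
  obtain ⟨h1, h2, h3⟩ := h
  refine ⟨?_, ?_, ?_⟩ <;> rw [p1_Y] <;> try rw [p1_re]
  all_goals linarith
lemma p2_T {z : ℂ} (h : z ∈ T) : p2 z ∈ T := by
  obtain ⟨h1, h2, h3⟩ := h
  refine ⟨?_, ?_, ?_⟩ <;> rw [p2_Y] <;> try rw [p2_re]
  all_goals linarith

/-- Contraction principle. -/
lemma approx {P B : Set ℂ} (hPb : Bornology.IsBounded P) (hBn : B.Nonempty) (hBc : IsClosed B)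
    (hP : ∀ x ∈ P, (∃ y ∈ P, x = p1 y) ∨ (∃ y ∈ P, x = p2 y))
    (h1 : ∀ x ∈ B, p1 x ∈ B) (h2 : ∀ x ∈ B, p2 x ∈ B) : P ⊆ B := by
  obtain ⟨b, hb⟩ := hBn
  obtain ⟨C, hC⟩ := hPb.subset_closedBall b
  set r : ℝ := (Real.sqrt 3)⁻¹ with hr
  have hr0 : 0 < r := by rw [hr]; exact inv_pos.2 s3pos
  have hr1 : r < 1 := by
    rw [hr]; apply inv_lt_one_of_one_lt₀
    rw [Real.lt_sqrt] <;> norm_num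
  have hrs : r * Real.sqrt 3 = 1 := inv_mul_cancel₀ s3pos.ne'
  have key : ∀ n : ℕ, ∀ x ∈ P, ∃ k ∈ B, dist x k ≤ C * r ^ n := by
    intro n
    induction n with
    | zero => intro x hx; exact ⟨b, hb, by simpa using hC hx⟩
    | succ n ih =>
      intro x hx
      rcases hP x hx with ⟨y, hy, rfl⟩ | ⟨y, hy, rfl⟩
      · obtain ⟨k, hk, hd⟩ := ih y hy
        refine ⟨p1 k, h1 k hk, ?_⟩
        have : dist (p1 y) (p1 k) = r * dist y k := by
          rw [← dist_p1 y k, ← mul_assoc, hrs, one_mul]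
        rw [this, pow_succ]
        nlinarith
      · obtain ⟨k, hk, hd⟩ := ih y hy
        refine ⟨p2 k, h2 k hk, ?_⟩
        have : dist (p2 y) (p2 k) = r * dist y k := by
          rw [← dist_p2 y k, ← mul_assoc, hrs, one_mul]
        rw [this, pow_succ]
        nlinarith
  intro x hx
  rw [← hBc.closure_eq, Metric.mem_closure_iff]
  intro ε hε
  have ht : Filter.Tendsto (fun n : ℕ => C * r ^ n) Filter.atTop (nhds (C * 0)) :=
    (tendsto_pow_atTop_nhds_zero_of_lt_one hr0.le hr1).const_mul C
  rw [mul_zero] at ht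
  obtain ⟨n, hn⟩ := (ht.eventually_lt_const hε).exists
  obtain ⟨k, hk, hd⟩ := key n x hx
  exact ⟨k, hk, hd.trans_lt hn⟩

structure IsK (K : Set ℂ) : Prop where
  ne : K.Nonempty
  cpt : IsCompact K
  eq : K = p1 '' K ∪ p2 '' K

def Sn (K : Set ℂ) : Set ℂ := K ∪ rh '' K ∪ rh '' (rh '' K)
def UU : Set ℂ := De ∪ (In ∪ rh '' In ∪ rh '' (rh '' In))


lemma K_p1 {K : Set ℂ} (hK : IsK K) {z : ℂ} (h : z ∈ K) : p1 z ∈ K := by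
  rw [hK.eq]; exact Or.inl ⟨z, h, rfl⟩
lemma K_p2 {K : Set ℂ} (hK : IsK K) {z : ℂ} (h : z ∈ K) : p2 z ∈ K := by
  rw [hK.eq]; exact Or.inr ⟨z, h, rfl⟩
lemma K_cases {K : Set ℂ} (hK : IsK K) {z : ℂ} (h : z ∈ K) : (∃ y ∈ K, z = p1 y) ∨ (∃ y ∈ K, z = p2 y) := by
  rw [hK.eq] at h
  rcases h with ⟨y, hy, rfl⟩ | ⟨y, hy, rfl⟩
  · exact Or.inl ⟨y, hy, rfl⟩
  · exact Or.inr ⟨y, hy, rfl⟩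

lemma K_T {K : Set ℂ} (hK : IsK K) : K ⊆ T := by
  apply approx hK.cpt.isBounded ⟨co 0 0, ?_⟩ closed_T (fun x hx => K_cases hK hx)
    (fun _ => p1_T) (fun _ => p2_T)
  refine ⟨?_, ?_, ?_⟩ <;> simp

lemma K_sg {K : Set ℂ} (hK : IsK K) {z : ℂ} (h : z ∈ K) : sg z ∈ K := by
  have : sg '' K ⊆ K := by
    apply approx (hK.cpt.image cont_sg).isBounded hK.ne hK.cpt.isClosed _
      (fun _ => K_p1 hK) (fun _ => K_p2 hK)
    rintro x ⟨y, hy, rfl⟩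
    rcases K_cases hK hy with ⟨w, hw, rfl⟩ | ⟨w, hw, rfl⟩
    · right; exact ⟨sg w, ⟨w, hw, rfl⟩, sg_p1 w⟩
    · left; exact ⟨sg w, ⟨w, hw, rfl⟩, sg_p2 w⟩
  exact this ⟨z, h, rfl⟩

lemma p1K_re {K : Set ℂ} (hK : IsK K) {z : ℂ} (h : z ∈ K) : (p1 z).re ≤ 1 / 2 := by
  obtain ⟨h1, h2, h3⟩ := K_T hK h
  rw [p1_re]; linarith
lemma p2K_re {K : Set ℂ} (hK : IsK K) {z : ℂ} (h : z ∈ K) : 1 / 2 ≤ (p2 z).re := by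
  obtain ⟨h1, h2, h3⟩ := K_T hK h
  rw [p2_re]; linarith

lemma p1_nK {K : Set ℂ} (hK : IsK K) {z : ℂ} (hR : z ∈ R) (h : z ∉ K) : p1 z ∉ K := by
  intro h'
  rcases K_cases hK h' with ⟨y, hy, he⟩ | ⟨y, hy, he⟩
  · rw [p1.injective he] at h; exact h hy
  · have := p1_R_re hR; have := p2K_re hK hy; rw [he] at *; linarith
lemma p2_nK {K : Set ℂ} (hK : IsK K) {z : ℂ} (hR : z ∈ R) (h : z ∉ K) : p2 z ∉ K := by
  intro h'
  rcases K_cases hK h' with ⟨y, hy, he⟩ | ⟨y, hy, he⟩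
  · have := p2_R_re hR; have := p1K_re hK hy; rw [he] at *; linarith
  · rw [p2.injective he] at h; exact h hy

lemma M_nK {K : Set ℂ} (hK : IsK K) {z : ℂ} (h : z ∈ M) : z ∉ K := by
  intro hz
  obtain ⟨h1, h2, h3⟩ := h
  rcases K_cases hK hz with ⟨y, hy, rfl⟩ | ⟨y, hy, rfl⟩
  · obtain ⟨k1, k2, k3⟩ := K_T hK hy
    rw [p1_re, p1_Y] at *
    rcases h3 with h3 | ⟨h3, h4⟩ <;> linarith
  · obtain ⟨k1, k2, k3⟩ := K_T hK hy
    rw [p2_re, p2_Y] at *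
    rcases h3 with h3 | ⟨h3, h4⟩ <;> linarith

lemma In_nK {K : Set ℂ} (hK : IsK K) : ∀ z ∈ In, z ∉ K := by
  have : ∀ z ∈ In, z ∈ R ∧ z ∉ K := by
    apply In_ind
    · exact fun z h => ⟨M_sub_R h, M_nK hK h⟩
    · exact fun z h => ⟨p1_R (p1_R h.1), p1_nK hK (p1_R h.1) (p1_nK hK h.1 h.2)⟩
    · exact fun z h => ⟨p1_R (p2_R h.1), p1_nK hK (p2_R h.1) (p2_nK hK h.1 h.2)⟩
    · exact fun z h => ⟨p2_R (p1_R h.1), p2_nK hK (p1_R h.1) (p1_nK hK h.1 h.2)⟩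
    · exact fun z h => ⟨p2_R (p2_R h.1), p2_nK hK (p2_R h.1) (p2_nK hK h.1 h.2)⟩
  exact fun z hz => (this z hz).2
lemma Out_nK {K : Set ℂ} (hK : IsK K) : ∀ z ∈ Out, z ∉ K := by
  rintro z (⟨w, hw, rfl⟩ | ⟨w, hw, rfl⟩)
  · exact p1_nK hK (In_sub_R w hw) (In_nK hK w hw)
  · exact p2_nK hK (In_sub_R w hw) (In_nK hK w hw)

lemma T_cover {K : Set ℂ} (hK : IsK K) {z : ℂ} (hT : z ∈ T) (hz : z ∉ K) : z ∈ In ∨ z ∈ Out := by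
  by_contra hcon
  have : T \ (In ∪ Out) ⊆ K := by
    apply approx (bdd_T.subset Set.diff_subset) hK.ne hK.cpt.isClosed _
      (fun _ => K_p1 hK) (fun _ => K_p2 hK)
    rintro x ⟨⟨h1, h2, h3⟩, hx⟩
    have hM : x ∉ M := fun h => hx (Or.inl (M_sub_In h))
    have hor : 3 * x.re - Yc x ≤ 1 ∨ 2 - 3 * x.re ≤ Yc x := by
      by_contra hh
      push Not at hh
      apply hM
      refine ⟨?_, ?_, Or.inr ⟨?_, ?_⟩⟩ <;> linarith [hh.1, hh.2]
    rcases hor with h | h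
    · left
      refine ⟨p1.symm x, ⟨⟨?_, ?_, ?_⟩, ?_⟩, (p1.apply_symm_apply x).symm⟩
      · rw [p1i_Y]; linarith
      · rw [p1i_Y, p1i_re]; linarith
      · rw [p1i_Y, p1i_re]; linarith
      · intro h'
        apply hx
        rcases h' with h' | h'
        · exact Or.inr (Or.inl ⟨_, h', p1.apply_symm_apply x⟩)
        · exact Or.inl (p1Out_sub ⟨_, h', p1.apply_symm_apply x⟩)
    · right
      refine ⟨p2.symm x, ⟨⟨?_, ?_, ?_⟩, ?_⟩, (p2.apply_symm_apply x).symm⟩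
      · rw [p2i_Y]; linarith
      · rw [p2i_Y, p2i_re]; linarith
      · rw [p2i_Y, p2i_re]; linarith
      · intro h'
        apply hx
        rcases h' with h' | h'
        · exact Or.inr (Or.inr ⟨_, h', p2.apply_symm_apply x⟩)
        · exact Or.inl (p2Out_sub ⟨_, h', p2.apply_symm_apply x⟩)
  exact hz (this ⟨hT, hcon⟩)

lemma S_R {K : Set ℂ} (hK : IsK K) {z : ℂ} (hR : z ∈ R) (h : z ∈ Sn K) : z ∈ K := by
  obtain ⟨r1, r2, r3, r4⟩ := hR
  rcases h with (h | ⟨k, hk, rfl⟩) | ⟨_, ⟨k, hk, rfl⟩, rfl⟩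
  · exact h
  · obtain ⟨k1, k2, k3⟩ := K_T hK hk
    simp only [rh_re, rh_Y] at *; linarith
  · obtain ⟨k1, k2, k3⟩ := K_T hK hk
    simp only [rh_re, rh_Y] at *; linarith

lemma S_half1 {K : Set ℂ} (hK : IsK K) {z : ℂ} (h : z ∈ Sn K) : Yc z ≤ z.re := by
  rcases h with (h | ⟨k, hk, rfl⟩) | ⟨_, ⟨k, hk, rfl⟩, rfl⟩
  · exact (K_T hK h).2.1
  · obtain ⟨k1, k2, k3⟩ := K_T hK hk
    simp only [rh_re, rh_Y] at *; linarith
  · obtain ⟨k1, k2, k3⟩ := K_T hK hk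
    simp only [rh_re, rh_Y] at *; linarith
lemma S_half2 {K : Set ℂ} (hK : IsK K) {z : ℂ} (h : z ∈ Sn K) : Yc z ≤ 1 - z.re := by
  rcases h with (h | ⟨k, hk, rfl⟩) | ⟨_, ⟨k, hk, rfl⟩, rfl⟩
  · exact (K_T hK h).2.2
  · obtain ⟨k1, k2, k3⟩ := K_T hK hk
    simp only [rh_re, rh_Y] at *; linarith
  · obtain ⟨k1, k2, k3⟩ := K_T hK hk
    simp only [rh_re, rh_Y] at *; linarith

lemma S_rh {K : Set ℂ} {z : ℂ} (h : z ∈ Sn K) : rh z ∈ Sn K := by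
  rcases h with (h | ⟨k, hk, rfl⟩) | ⟨_, ⟨k, hk, rfl⟩, rfl⟩
  · exact Or.inl (Or.inr ⟨z, h, rfl⟩)
  · exact Or.inr ⟨_, ⟨k, hk, rfl⟩, rfl⟩
  · rw [rh3]; exact Or.inl (Or.inl hk)
lemma nS_rh {K : Set ℂ} {z : ℂ} (h : z ∉ Sn K) : rh z ∉ Sn K := fun h' => h (by
  have := S_rh (S_rh h'); rwa [rh3] at this)
lemma De_rh {z : ℂ} (h : z ∈ De) : rh z ∈ De := by
  obtain ⟨h1, h2, h3⟩ := h
  refine ⟨?_, ?_, ?_⟩ <;> simp only [rh_re, rh_Y] <;> linarith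
lemma UU_rh {z : ℂ} (h : z ∈ UU) : rh z ∈ UU := by
  rcases h with h | (h | ⟨k, hk, rfl⟩) | ⟨_, ⟨k, hk, rfl⟩, rfl⟩
  · exact Or.inl (De_rh h)
  · exact Or.inr (Or.inl (Or.inr ⟨z, h, rfl⟩))
  · exact Or.inr (Or.inr ⟨_, ⟨k, hk, rfl⟩, rfl⟩)
  · rw [rh3]; exact Or.inr (Or.inl (Or.inl hk))
lemma nUU_rh {z : ℂ} (h : z ∉ UU) : rh z ∉ UU := fun h' => h (by
  have := UU_rh (UU_rh h'); rwa [rh3] at this)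

lemma De_nS {K : Set ℂ} (hK : IsK K) {z : ℂ} (h : z ∈ De) : z ∉ Sn K := by
  have key : ∀ w ∈ De, w ∉ K := fun w hw hk => by
    have := (K_T hK hk).1; have := hw.1; linarith
  rintro ((h' | ⟨k, hk, rfl⟩) | ⟨_, ⟨k, hk, rfl⟩, rfl⟩)
  · exact key z h h'
  · have := De_rh (De_rh h); rw [rh3] at this; exact key _ this hk
  · have := De_rh h; rw [rh3] at this; exact key _ this hk

lemma In_nS {K : Set ℂ} (hK : IsK K) {z : ℂ} (h : z ∈ In) : z ∉ Sn K := fun h' =>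
  In_nK hK z h (S_R hK (In_sub_R z h) h')
lemma Out_nS {K : Set ℂ} (hK : IsK K) {z : ℂ} (h : z ∈ Out) : z ∉ Sn K := fun h' =>
  Out_nK hK z h (S_R hK (Out_sub_R z h) h')

lemma UU_nS {K : Set ℂ} (hK : IsK K) : UU ⊆ (Sn K)ᶜ := by
  rintro z (h | (h | ⟨k, hk, rfl⟩) | ⟨_, ⟨k, hk, rfl⟩, rfl⟩)
  · exact De_nS hK h
  · exact In_nS hK h
  · exact nS_rh (In_nS hK hk)
  · exact nS_rh (nS_rh (In_nS hK hk))

lemma preconn_UU : IsPreconnected UU := by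
  have e : UU = (De ∪ In) ∪ ((De ∪ rh '' In) ∪ (De ∪ rh '' (rh '' In))) := by
    ext z; simp only [UU, Set.mem_union]; tauto
  have c1 := preconn_In.image _ cont_rh.continuousOn
  have c2 := c1.image _ cont_rh.continuousOn
  rw [e]
  refine IsPreconnected.union m0 (Or.inl m0_De) (Or.inl (Or.inl m0_De)) ?_ ?_
  · exact IsPreconnected.union m0 m0_De m0_In preconn_De preconn_In
  · refine IsPreconnected.union m0 (Or.inl m0_De) (Or.inl m0_De) ?_ ?_
    · exact IsPreconnected.union _ (De_rh m0_De) ⟨_, m0_In, rfl⟩ preconn_De c1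
    · exact IsPreconnected.union _ (De_rh (De_rh m0_De)) ⟨_, ⟨_, m0_In, rfl⟩, rfl⟩ preconn_De c2

/-- `z` lies in an unbounded connected subset of the complement of the snowflake curve. -/
def Unb (K : Set ℂ) (z : ℂ) : Prop :=
  ∃ V : Set ℂ, IsPreconnected V ∧ z ∈ V ∧ V ⊆ (Sn K)ᶜ ∧ ¬ Bornology.IsBounded V

lemma unb_of {V : Set ℂ} (h : ∀ t : ℝ, 1 < t → co 0 t ∈ V) : ¬ Bornology.IsBounded V := by
  intro hb
  obtain ⟨C, hC⟩ := hb.subset_closedBall 0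
  have h1 := hC (h (2 * |C| + 2) (by linarith [abs_nonneg C]))
  rw [mem_closedBall] at h1
  have h2 := dist_sq (co 0 (2 * |C| + 2)) 0
  have h3 : Yc 0 = 0 := by simp [Yc]
  rw [Yc_co, co_re, h3] at h2
  have h4 := dist_nonneg (x := co 0 (2 * |C| + 2)) (y := 0)
  have h5 : C = |C| := (abs_of_nonneg (h4.trans h1)).symm
  rw [Complex.zero_re] at h2
  have h6 := pow_le_pow_left₀ h4 h1 2
  rw [← h5] at h2 h6
  nlinarith [h4.trans h1]

lemma Unb_rh {K : Set ℂ} {z : ℂ} (h : Unb K z) : Unb K (rh z) := by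
  obtain ⟨V, h1, h2, h3, h4⟩ := h
  refine ⟨rh '' V, h1.image _ cont_rh.continuousOn, ⟨z, h2, rfl⟩, ?_, ?_⟩
  · rintro _ ⟨w, hw, rfl⟩; exact nS_rh (h3 hw)
  · intro hb
    apply h4
    have hl : LipschitzWith 1 rh := LipschitzWith.of_dist_le_mul fun x y => by
      rw [dist_rh]; simp
    have := hl.isBounded_image (hl.isBounded_image hb)
    apply this.subset
    intro w hw
    exact ⟨_, ⟨_, ⟨w, hw, rfl⟩, rfl⟩, rh3 w⟩

lemma unb_h1 {K : Set ℂ} (hK : IsK K) : {z : ℂ | 1 * z.re + (-1) * Yc z < 0} ⊆ (Sn K)ᶜ := by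
  intro z hz hS
  have := S_half1 hK hS
  simp only [Set.mem_ofPred_eq] at hz; linarith
lemma unb_h2 {K : Set ℂ} (hK : IsK K) : {z : ℂ | (-1) * z.re + (-1) * Yc z < -1} ⊆ (Sn K)ᶜ := by
  intro z hz hS
  have := S_half2 hK hS
  simp only [Set.mem_ofPred_eq] at hz; linarith

lemma Unb_W {K : Set ℂ} (hK : IsK K) {z : ℂ} (hz : z ∉ Sn K) (hU : z ∉ UU) (w1 : 0 ≤ z.re + Yc z)
    (w2 : 0 ≤ 1 - z.re + Yc z) : Unb K z := by
  have u1 : ¬ Bornology.IsBounded {z : ℂ | 1 * z.re + (-1) * Yc z < 0} := by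
    apply unb_of; intro t ht; simp only [Set.mem_ofPred_eq, co_re, Yc_co]; linarith
  have u2 : ¬ Bornology.IsBounded {z : ℂ | (-1) * z.re + (-1) * Yc z < -1} := by
    apply unb_of; intro t ht; simp only [Set.mem_ofPred_eq, co_re, Yc_co]; linarith
  by_cases h1 : Yc z ≤ z.re
  swap
  · refine ⟨_, preconn_lt 1 (-1) 0, ?_, unb_h1 hK, u1⟩
    simp only [Set.mem_ofPred_eq]; linarith
  by_cases h2 : Yc z ≤ 1 - z.re
  swap
  · refine ⟨_, preconn_lt (-1) (-1) (-1), ?_, unb_h2 hK, u2⟩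
    simp only [Set.mem_ofPred_eq]; linarith
  by_cases h3 : 0 ≤ Yc z
  swap
  · exfalso; apply hU; left; refine ⟨?_, ?_, ?_⟩ <;> linarith
  have hzK : z ∉ K := fun h => hz (Or.inl (Or.inl h))
  rcases T_cover hK ⟨h3, h1, h2⟩ hzK with h | h
  · exact absurd (Or.inr (Or.inl (Or.inl h))) hU
  · rcases h with h | h
    · refine ⟨p1 '' In ∪ {z : ℂ | 1 * z.re + (-1) * Yc z < 0}, ?_, Or.inl h, ?_, ?_⟩
      · refine IsPreconnected.union (p1 m0) ⟨_, m0_In, rfl⟩ ?_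
          (preconn_In.image _ cont_p1.continuousOn) (preconn_lt _ _ _)
        simp only [Set.mem_ofPred_eq, p1_re, p1_Y]; norm_num [m0]
      · exact Set.union_subset (fun w hw => Out_nS hK (Or.inl hw)) (unb_h1 hK)
      · exact fun hb => u1 (hb.subset Set.subset_union_right)
    · refine ⟨p2 '' In ∪ {z : ℂ | (-1) * z.re + (-1) * Yc z < -1}, ?_, Or.inl h, ?_, ?_⟩
      · refine IsPreconnected.union (p2 m0) ⟨_, m0_In, rfl⟩ ?_
          (preconn_In.image _ cont_p2.continuousOn) (preconn_lt _ _ _)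
        simp only [Set.mem_ofPred_eq, p2_re, p2_Y]; norm_num [m0]
      · exact Set.union_subset (fun w hw => Out_nS hK (Or.inr hw)) (unb_h2 hK)
      · exact fun hb => u2 (hb.subset Set.subset_union_right)

lemma Unb_all {K : Set ℂ} (hK : IsK K) {z : ℂ} (hz : z ∉ Sn K) (hU : z ∉ UU) : Unb K z := by
  by_cases hw : 0 ≤ z.re + Yc z ∧ 0 ≤ 1 - z.re + Yc z
  · exact Unb_W hK hz hU hw.1 hw.2
  by_cases hw1 : 0 ≤ (rh z).re + Yc (rh z) ∧ 0 ≤ 1 - (rh z).re + Yc (rh z)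
  · have := Unb_rh (Unb_rh (Unb_W hK (nS_rh hz) (nUU_rh hU) hw1.1 hw1.2))
    rwa [rh3] at this
  · have := Unb_rh (Unb_W hK (nS_rh (nS_rh hz)) (nUU_rh (nUU_rh hU)) ?_ ?_)
    · rwa [rh3] at this
    all_goals
      simp only [rh_re, rh_Y] at *
      rw [not_and_or, not_le, not_le] at hw hw1
      rcases hw with hw | hw <;> rcases hw1 with hw1 | hw1 <;> linarith

lemma Omega_eq {K : Set ℂ} (hK : IsK K) {Ω : Set ℂ} (hb : Bornology.IsBounded Ω)
    (hΩ : ∃ x ∈ (Sn K)ᶜ, Ω = connectedComponentIn (Sn K)ᶜ x) : Ω = UU := by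
  obtain ⟨x, hx, rfl⟩ := hΩ
  have h1 : connectedComponentIn (Sn K)ᶜ x ⊆ UU := by
    intro y hy
    by_contra hyU
    obtain ⟨V, v1, v2, v3, v4⟩ := Unb_all hK (connectedComponentIn_subset _ _ hy) hyU
    apply v4
    apply hb.subset
    rw [connectedComponentIn_eq hy]
    exact v1.subset_connectedComponentIn v2 v3
  apply Set.Subset.antisymm h1
  exact preconn_UU.subset_connectedComponentIn (h1 (mem_connectedComponentIn hx)) (UU_nS hK)

def nb (A : Set ℂ) (ε : ℝ) : Set ℂ := {z | ∃ k ∈ A, dist z k ≤ ε}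

lemma nb_mono {A B : Set ℂ} (h : A ⊆ B) {ε : ℝ} {z : ℂ} (hz : z ∈ nb A ε) : z ∈ nb B ε := by
  obtain ⟨k, hk, hd⟩ := hz
  exact ⟨k, h hk, hd⟩

lemma nb_iff {A : Set ℂ} (hc : IsCompact A) (hn : A.Nonempty) (ε : ℝ) (z : ℂ) :
    z ∈ nb A ε ↔ infDist z A ≤ ε := by
  constructor
  · rintro ⟨k, hk, hd⟩; exact (infDist_le_dist_of_mem hk).trans hd
  · intro h
    obtain ⟨k, hk, hd⟩ := hc.exists_infDist_eq_dist hn z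
    exact ⟨k, hk, hd ▸ h⟩

lemma meas_nb {A : Set ℂ} (hc : IsCompact A) (hn : A.Nonempty) (ε : ℝ) : MeasurableSet (nb A ε) := by
  have : nb A ε = {z | infDist z A ≤ ε} := by ext z; exact nb_iff hc hn ε z
  rw [this]
  exact (isClosed_le (continuous_infDist_pt A) continuous_const).measurableSet

lemma nb_p1 (A : Set ℂ) (ε : ℝ) (z : ℂ) : p1 z ∈ nb (p1 '' A) ε ↔ z ∈ nb A (Real.sqrt 3 * ε) := by
  constructor
  · rintro ⟨_, ⟨k, hk, rfl⟩, hd⟩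
    refine ⟨k, hk, ?_⟩
    rw [← dist_p1]; exact mul_le_mul_of_nonneg_left hd s3pos.le
  · rintro ⟨k, hk, hd⟩
    refine ⟨p1 k, ⟨k, hk, rfl⟩, ?_⟩
    rw [← dist_p1] at hd; exact le_of_mul_le_mul_left hd s3pos
lemma nb_p2 (A : Set ℂ) (ε : ℝ) (z : ℂ) : p2 z ∈ nb (p2 '' A) ε ↔ z ∈ nb A (Real.sqrt 3 * ε) := by
  constructor
  · rintro ⟨_, ⟨k, hk, rfl⟩, hd⟩
    refine ⟨k, hk, ?_⟩
    rw [← dist_p2]; exact mul_le_mul_of_nonneg_left hd s3pos.le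
  · rintro ⟨k, hk, hd⟩
    refine ⟨p2 k, ⟨k, hk, rfl⟩, ?_⟩
    rw [← dist_p2] at hd; exact le_of_mul_le_mul_left hd s3pos
lemma nb_ch (A : Set ℂ) (ε : ℝ) (z : ℂ) : ch z ∈ nb (ch '' A) (ε / 3) ↔ z ∈ nb A ε := by
  constructor
  · rintro ⟨_, ⟨k, hk, rfl⟩, hd⟩
    refine ⟨k, hk, ?_⟩
    rw [← dist_ch]; linarith
  · rintro ⟨k, hk, hd⟩
    refine ⟨ch k, ⟨k, hk, rfl⟩, ?_⟩
    rw [← dist_ch] at hd; linarith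

lemma dist_le_dist {z a b : ℂ} (h : (z.re - a.re) ^ 2 + (Yc z - Yc a) ^ 2 / 3 ≤
    (z.re - b.re) ^ 2 + (Yc z - Yc b) ^ 2 / 3) : dist z a ≤ dist z b := by
  apply dist_le_of dist_nonneg
  rw [dist_sq]; exact h

lemma fold_sg {z k : ℂ} (h : 0 ≤ (z.re - 1 / 2) * (k.re - 1 / 2)) : dist z k ≤ dist z (sg k) := by
  apply dist_le_dist
  rw [sg_re, sg_Y]; nlinarith

lemma nb_sg {K : Set ℂ} (hK : IsK K) {ε : ℝ} {z : ℂ} (h : z ∈ nb K ε) : sg z ∈ nb K ε := by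
  obtain ⟨k, hk, hd⟩ := h
  exact ⟨sg k, K_sg hK hk, by rwa [dist_sg]⟩

lemma fold1 {K : Set ℂ} (hK : IsK K) {ε : ℝ} {z : ℂ} (hz : z.re ≤ 1 / 2) :
    z ∈ nb K ε ↔ z ∈ nb (p1 '' K) ε := by
  constructor
  · rintro ⟨k, hk, hd⟩
    rcases K_cases hK hk with ⟨y, hy, rfl⟩ | ⟨y, hy, rfl⟩
    · exact ⟨p1 y, ⟨y, hy, rfl⟩, hd⟩
    · refine ⟨sg (p2 y), ⟨sg y, K_sg hK hy, (sg_p2 y).symm⟩, le_trans ?_ hd⟩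
      have := fold_sg (z := z) (k := sg (p2 y)) ?_
      · rwa [sg_sg] at this
      · have := p2K_re hK hy
        rw [sg_re]; nlinarith
  · rintro ⟨_, ⟨k, hk, rfl⟩, hd⟩
    exact ⟨_, K_p1 hK hk, hd⟩

lemma fold2 {K : Set ℂ} (hK : IsK K) {ε : ℝ} {z : ℂ} (hz : 1 / 2 ≤ z.re) (h : z ∈ nb K ε) :
    z ∈ nb (p2 '' K) ε := by
  have h1 := (fold1 hK (z := sg z) (by rw [sg_re]; linarith)).1 (nb_sg hK h)
  obtain ⟨_, ⟨k, hk, rfl⟩, hd⟩ := h1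
  refine ⟨sg (p1 k), ⟨sg k, K_sg hK hk, (sg_p1 k).symm⟩, ?_⟩
  rwa [← dist_sg, sg_sg]

lemma foldS {K : Set ℂ} (hK : IsK K) {ε : ℝ} {z : ℂ} (h1 : 0 ≤ z.re + Yc z)
    (h2 : 0 ≤ 1 - z.re + Yc z) : z ∈ nb (Sn K) ε ↔ z ∈ nb K ε := by
  constructor
  · rintro ⟨k, (h | ⟨k, hk, rfl⟩) | ⟨_, ⟨k, hk, rfl⟩, rfl⟩, hd⟩
    · exact ⟨k, h, hd⟩
    · refine ⟨sg k, K_sg hK hk, le_trans (dist_le_dist ?_) hd⟩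
      obtain ⟨k1, k2, k3⟩ := K_T hK hk
      have : 0 ≤ 1 - k.re + Yc k := by linarith
      simp only [sg_re, sg_Y, rh_re, rh_Y]
      nlinarith [mul_nonneg h1 this]
    · refine ⟨sg k, K_sg hK hk, le_trans (dist_le_dist ?_) hd⟩
      obtain ⟨k1, k2, k3⟩ := K_T hK hk
      have : 0 ≤ k.re + Yc k := by linarith
      simp only [sg_re, sg_Y, rh_re, rh_Y]
      nlinarith [mul_nonneg h2 this]
  · exact nb_mono fun x hx => Or.inl (Or.inl hx)

lemma nbS_rh {K : Set ℂ} {ε : ℝ} {z : ℂ} (h : z ∈ nb (Sn K) ε) : rh z ∈ nb (Sn K) ε := by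
  obtain ⟨k, hk, hd⟩ := h
  exact ⟨rh k, S_rh hk, by rwa [dist_rh]⟩

/-! The outer region. -/
def Mp : Set ℂ := {z | Yc z < 3 * z.re ∧ 3 * z.re + Yc z < 3 ∧ (z.re < Yc z ∨ 1 - z.re < Yc z)}
def Ao : Set ℂ := Mp ∪ Out
def X : Set ℂ := {z | z.re < 1 / 2 ∧ 1 / 2 < Yc z ∧ Yc z < 3 * z.re}

lemma Ao_sub_R : Ao ⊆ R := by
  rintro z (⟨h1, h2, h3⟩ | h)
  · rcases h3 with h3 | h3 <;> refine ⟨?_, ?_, ?_, ?_⟩ <;> linarith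
  · exact Out_sub_R z h

lemma Ao_sg {z : ℂ} (h : z ∈ Ao) : sg z ∈ Ao := by
  rcases h with ⟨h1, h2, h3⟩ | ⟨w, hw, rfl⟩ | ⟨w, hw, rfl⟩
  · left
    refine ⟨?_, ?_, ?_⟩ <;> simp only [sg_re, sg_Y]
    · linarith
    · linarith
    · rcases h3 with h3 | h3
      · right; linarith
      · left; linarith
  · right; right; exact ⟨sg w, In_sg w hw, (sg_p1 w).symm⟩
  · right; left; exact ⟨sg w, In_sg w hw, (sg_p2 w).symm⟩

lemma open_Mp : IsOpen Mp := by
  have h1 := cont_Yc; have h2 := Complex.continuous_re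
  unfold Mp
  exact IsOpen.inter (s := {z : ℂ | Yc z < 3 * z.re}) (isOpen_lt (by fun_prop) (by fun_prop))
    (IsOpen.inter (s := {z : ℂ | 3 * z.re + Yc z < 3}) (isOpen_lt (by fun_prop) (by fun_prop))
    (IsOpen.union (s₁ := {z : ℂ | z.re < Yc z}) (s₂ := {z : ℂ | 1 - z.re < Yc z})
      (isOpen_lt (by fun_prop) (by fun_prop)) (isOpen_lt (by fun_prop) (by fun_prop))))
lemma open_Ao : IsOpen Ao := open_Mp.union open_Out
lemma open_X : IsOpen X := by
  have h1 := cont_Yc; have h2 := Complex.continuous_re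
  unfold X
  exact IsOpen.inter (s := {z : ℂ | z.re < 1 / 2}) (isOpen_lt (by fun_prop) (by fun_prop))
    (IsOpen.inter (s := {z : ℂ | 1 / 2 < Yc z}) (t := {z : ℂ | Yc z < 3 * z.re})
    (isOpen_lt (by fun_prop) (by fun_prop)) (isOpen_lt (by fun_prop) (by fun_prop)))
lemma bdd_X : Bornology.IsBounded X := by
  apply bdd_of 3
  rintro z ⟨h1, h2, h3⟩
  constructor <;> rw [abs_le] <;> constructor <;> linarith

lemma In_half (z : ℂ) : (p1 z ∈ In ∧ (p1 z).re < 1 / 2) ↔ z ∈ Ao := by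
  constructor
  · rintro ⟨h, hr⟩
    rw [In_eq] at h
    rcases h with h | ⟨w, hw, he⟩ | ⟨w, hw, he⟩
    · left
      obtain ⟨h1, h2, h3⟩ := h
      rw [p1_re, p1_Y] at *
      refine ⟨by linarith, by linarith, ?_⟩
      rcases h3 with h3 | ⟨h3, h4⟩
      · left; linarith
      · right; linarith
    · right; rwa [← p1.injective he]
    · exfalso; have := p2_R_re (Out_sub_R w hw); rw [he] at this; linarith
  · intro h
    refine ⟨?_, p1_R_re (Ao_sub_R h)⟩
    rcases h with ⟨h1, h2, h3⟩ | h
    · apply M_sub_In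
      refine ⟨?_, ?_, ?_⟩ <;> rw [p1_re, p1_Y]
      · linarith
      · linarith
      · rcases h3 with h3 | h3
        · left; linarith
        · right; constructor <;> linarith
    · exact p1Out_sub ⟨z, h, rfl⟩

lemma Ao_half {z : ℂ} (hY : Yc z ≠ 1 / 2) : (z ∈ Ao ∧ z.re < 1 / 2) ↔ (z ∈ p1 '' In ∨ z ∈ X) := by
  constructor
  · rintro ⟨⟨h1, h2, h3⟩ | h | ⟨w, hw, rfl⟩, hr⟩
    · have h4 : z.re < Yc z := by rcases h3 with h3 | h3 <;> linarith
      rcases lt_or_gt_of_ne hY with h | h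
      · left
        refine ⟨p1.symm z, M_sub_In ⟨?_, ?_, Or.inl ?_⟩, p1.apply_symm_apply z⟩ <;>
          simp only [p1i_re, p1i_Y] <;> linarith
      · right; exact ⟨hr, h, h1⟩
    · exact Or.inl h
    · exfalso; have := p2_R_re (In_sub_R w hw); linarith
  · rintro (⟨w, hw, rfl⟩ | ⟨h1, h2, h3⟩)
    · exact ⟨Or.inr (Or.inl ⟨w, hw, rfl⟩), p1_R_re (In_sub_R w hw)⟩
    · refine ⟨Or.inl ⟨h3, ?_, Or.inl ?_⟩, h1⟩ <;> linarith

/-! Measure computations. -/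
lemma ae_line (a b d : ℝ) (h : a ≠ 0 ∨ b ≠ 0) {B C : Set ℂ}
    (hBC : ∀ z : ℂ, a * z.re + b * Yc z ≠ d → (z ∈ B ↔ z ∈ C)) : volume.real B = volume.real C := by
  apply measureReal_congr
  have : {z : ℂ | a * z.re + b * Yc z = d}ᶜ ∈ ae (volume : Measure ℂ) :=
    compl_mem_ae_iff.2 (line_null a b d h)
  filter_upwards [this] with z hz
  exact propext (hBC z hz)

lemma half {B : Set ℂ} (hb : Bornology.IsBounded B)
    (hs : ∀ z ∈ B, sg z ∈ B) : volume.real B = 2 * volume.real (B ∩ {z | z.re < 1 / 2}) := by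
  have hH : MeasurableSet {z : ℂ | z.re < 1 / 2} :=
    (isOpen_lt Complex.continuous_re continuous_const).measurableSet
  rw [← measureReal_inter_add_sdiff (μ := volume) (s := B) hH hb.measure_lt_top.ne]
  have : volume.real (B \ {z | z.re < 1 / 2}) = volume.real (sg '' (B ∩ {z | z.re < 1 / 2})) := by
    apply ae_line 1 0 (1 / 2) (Or.inl one_ne_zero)
    intro z hz
    have hz' : z.re ≠ 1 / 2 := by intro h; apply hz; rw [h]; ring
    constructor
    · rintro ⟨h1, h2⟩
      have h2' : 1 / 2 ≤ z.re := not_lt.1 h2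
      refine ⟨sg z, ⟨hs z h1, ?_⟩, sg_sg z⟩
      show (sg z).re < 1 / 2
      rw [sg_re]; have := lt_of_le_of_ne h2' hz'.symm; linarith
    · rintro ⟨w, ⟨hw, hr⟩, rfl⟩
      refine ⟨hs w hw, ?_⟩
      show ¬ (sg w).re < 1 / 2
      have : w.re < 1 / 2 := hr
      rw [sg_re]; linarith
  rw [this, vol_sg]; ring

def fIn (K : Set ℂ) (ε : ℝ) : ℝ := volume.real (In ∩ nb K ε)
def fA (K : Set ℂ) (ε : ℝ) : ℝ := volume.real (Ao ∩ nb K ε)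
def fw (K : Set ℂ) (ε : ℝ) : ℝ := volume.real (X ∩ nb (p1 '' K) ε)

lemma bdd_In : Bornology.IsBounded In := bdd_R.subset In_sub_R

lemma fIn_eq {K : Set ℂ} (hK : IsK K) (ε : ℝ) : fIn K ε = 2 / 3 * fA K (Real.sqrt 3 * ε) := by
  unfold fIn fA
  rw [half (bdd_In.subset Set.inter_subset_left) fun z hz => ⟨In_sg z hz.1, nb_sg hK hz.2⟩]
  have : In ∩ nb K ε ∩ {z | z.re < 1 / 2} = p1 '' (Ao ∩ nb K (Real.sqrt 3 * ε)) := by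
    rw [Equiv.image_eq_preimage_symm]
    ext z
    obtain ⟨y, rfl⟩ := p1.surjective z
    rw [Set.mem_preimage, p1.symm_apply_apply]
    constructor
    · rintro ⟨⟨h1, h2⟩, h3⟩
      have h3' : (p1 y).re < 1 / 2 := h3
      exact ⟨(In_half y).1 ⟨h1, h3'⟩, (nb_p1 K ε y).1 ((fold1 hK h3'.le).1 h2)⟩
    · rintro ⟨h1, h2⟩
      obtain ⟨h3, h4⟩ := (In_half y).2 h1
      exact ⟨⟨h3, (fold1 hK h4.le).2 ((nb_p1 K ε y).2 h2)⟩, h4⟩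
  rw [this, vol_p1]; ring

lemma cpt_p1 {K : Set ℂ} (hK : IsK K) : IsCompact (p1 '' K) := hK.cpt.image cont_p1

lemma fA_eq {K : Set ℂ} (hK : IsK K) (ε : ℝ) :
    fA K ε = 2 / 3 * fIn K (Real.sqrt 3 * ε) + 2 * fw K ε := by
  unfold fIn fA fw
  rw [half (bdd_R.subset (Set.inter_subset_left.trans Ao_sub_R))
    fun z hz => ⟨Ao_sg hz.1, nb_sg hK hz.2⟩]
  have e : volume.real (Ao ∩ nb K ε ∩ {z | z.re < 1 / 2}) =
      volume.real (p1 '' (In ∩ nb K (Real.sqrt 3 * ε)) ∪ (X ∩ nb (p1 '' K) ε)) := by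
    apply ae_line 0 1 (1 / 2) (Or.inr one_ne_zero)
    intro z hz
    have hz' : Yc z ≠ 1 / 2 := by intro h; apply hz; rw [h]; ring
    constructor
    · rintro ⟨⟨h1, h2⟩, h3⟩
      have h3' : z.re < 1 / 2 := h3
      have h4 := (fold1 hK h3'.le).1 h2
      rcases (Ao_half hz').1 ⟨h1, h3'⟩ with ⟨y, hy, rfl⟩ | h
      · left; exact ⟨y, ⟨hy, (nb_p1 K ε y).1 h4⟩, rfl⟩
      · right; exact ⟨h, h4⟩
    · rintro (⟨y, ⟨hy, h⟩, rfl⟩ | ⟨h1, h2⟩)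
      · obtain ⟨h3, h4⟩ := (Ao_half hz').2 (Or.inl ⟨y, hy, rfl⟩)
        exact ⟨⟨h3, (fold1 hK h4.le).2 ((nb_p1 K ε y).2 h)⟩, h4⟩
      · obtain ⟨h3, h4⟩ := (Ao_half hz').2 (Or.inr h1)
        exact ⟨⟨h3, (fold1 hK h4.le).2 h2⟩, h4⟩
  have hd : Disjoint (p1 '' (In ∩ nb K (Real.sqrt 3 * ε))) (X ∩ nb (p1 '' K) ε) := by
    rw [Set.disjoint_left]
    rintro _ ⟨y, ⟨hy, _⟩, rfl⟩ ⟨⟨_, h2, _⟩, _⟩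
    have := p1_R_Y (In_sub_R y hy); linarith
  rw [e, measureReal_union hd (open_X.measurableSet.inter (meas_nb (cpt_p1 hK) (hK.ne.image _) ε))
    ((bdd_R.subset (by rintro _ ⟨y, ⟨hy, _⟩, rfl⟩; exact p1_R (In_sub_R y hy))).measure_lt_top.ne)
    ((bdd_X.subset Set.inter_subset_left).measure_lt_top.ne), vol_p1]
  ring

lemma loc {K : Set ℂ} (hK : IsK K) {δ : ℝ} {z : ℂ} (h1 : z.re < 1 / 2) (h2 : 1 / 2 < Yc z)
    (h : z ∈ nb (p1 '' K) δ) : 1 / 2 - 3 * δ ≤ z.re ∧ Yc z ≤ 1 / 2 + 3 * δ := by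
  obtain ⟨_, ⟨k, hk, rfl⟩, hd⟩ := h
  obtain ⟨k1, k2, k3⟩ := K_T hK hk
  have h0 := dist_nonneg.trans hd
  have hs := pow_le_pow_left₀ dist_nonneg hd 2
  rw [dist_sq] at hs
  have a1 : |z.re - (p1 k).re| ≤ δ := abs_le_of_sq_le_sq (by nlinarith [sq_nonneg (Yc z - Yc (p1 k))]) h0
  have a2 : |Yc z - Yc (p1 k)| ≤ 2 * δ :=
    abs_le_of_sq_le_sq (by nlinarith [sq_nonneg (z.re - (p1 k).re)]) (by linarith)
  rw [abs_le] at a1 a2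
  rw [p1_re] at a1; rw [p1_Y] at a2
  constructor <;> linarith [a1.1, a1.2, a2.1, a2.2]

lemma nb_near {K : Set ℂ} (hK : IsK K) {δ : ℝ} (hδ : δ ≤ 1 / 50) {z : ℂ} (h1 : z.re < 1 / 2)
    (h2 : 1 / 2 < Yc z) (h : z ∈ nb (p1 '' K) δ) : z ∈ nb (ch '' (p1 '' K)) δ := by
  obtain ⟨l1, l2⟩ := loc hK h1 h2 h
  obtain ⟨y, rfl⟩ := p1.surjective z
  obtain ⟨x, rfl⟩ := p2.surjective y
  rw [p1_re, p2_re, p2_Y] at h1 l1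
  rw [p1_Y, p2_re, p2_Y] at h2 l2
  rw [nb_p1] at h
  have h' := fold2 hK (by rw [p2_re]; linarith) h
  rw [nb_p2] at h'
  have h'' := fold2 hK (by linarith) h'
  obtain ⟨_, ⟨k, hk, rfl⟩, hd⟩ := h''
  refine ⟨p1 (p2 (p2 k)), ⟨p1 k, ⟨k, hk, rfl⟩, ch_p1 k⟩, ?_⟩
  rw [← dist_p2, ← dist_p1] at hd
  exact le_of_mul_le_mul_left (le_of_mul_le_mul_left hd s3pos) s3pos

lemma fw_eq {K : Set ℂ} (hK : IsK K) {δ : ℝ} (h0 : 0 < δ) (hδ : δ ≤ 1 / 50) :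
    fw K (δ / 3) = 1 / 9 * fw K δ := by
  unfold fw
  rw [← vol_ch]
  congr 1
  rw [ch.image_eq_preimage_symm]
  ext z
  obtain ⟨y, rfl⟩ := ch.surjective z
  rw [Set.mem_preimage, ch.symm_apply_apply]
  have hsub : ch '' (p1 '' K) ⊆ p1 '' K := by
    rintro _ ⟨_, ⟨k, hk, rfl⟩, rfl⟩
    exact ⟨_, K_p2 hK (K_p2 hK hk), (ch_p1 k).symm⟩
  constructor
  · rintro ⟨⟨h1, h2, h3⟩, h⟩
    have h' := nb_near hK (by linarith) h1 h2 h
    obtain ⟨l1, l2⟩ := loc hK h1 h2 h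
    rw [nb_ch] at h'
    rw [ch_re] at h1 l1; rw [ch_Y] at h2 l2
    refine ⟨⟨?_, ?_, ?_⟩, h'⟩ <;> linarith
  · rintro ⟨⟨h1, h2, h3⟩, h⟩
    refine ⟨⟨?_, ?_, ?_⟩, nb_mono hsub ((nb_ch _ _ _).2 h)⟩
    · rw [ch_re]; linarith
    · rw [ch_Y]; linarith
    · rw [ch_re, ch_Y]; linarith

lemma cpt_S {K : Set ℂ} (hK : IsK K) : IsCompact (Sn K) :=
  (hK.cpt.union (hK.cpt.image cont_rh)).union ((hK.cpt.image cont_rh).image cont_rh)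
lemma ne_S {K : Set ℂ} (hK : IsK K) : (Sn K).Nonempty := hK.ne.mono fun _ h => Or.inl (Or.inl h)

lemma meas_rh {A : Set ℂ} (h : MeasurableSet A) : MeasurableSet (rh '' A) := by
  have : rh '' A = (fun z => rh (rh z)) ⁻¹' A := by
    ext z
    constructor
    · rintro ⟨w, hw, rfl⟩; show rh (rh (rh w)) ∈ A; rwa [rh3]
    · intro h; exact ⟨_, h, rh3 z⟩
  rw [this]
  exact (cont_rh.comp cont_rh).measurable h

lemma vol_UU {K : Set ℂ} (hK : IsK K) (ε : ℝ) :
    volume.real (UU ∩ nb (Sn K) ε) = 3 * fIn K ε := by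
  set B := In ∩ nb K ε with hB
  have hBm : MeasurableSet B := open_In.measurableSet.inter (meas_nb hK.cpt hK.ne ε)
  have hBS : ∀ z, z ∈ B ↔ z ∈ In ∧ z ∈ nb (Sn K) ε := by
    intro z
    constructor
    · rintro ⟨h1, h2⟩
      have hR := In_sub_R z h1
      exact ⟨h1, (foldS hK hR.1.le hR.2.1.le).2 h2⟩
    · rintro ⟨h1, h2⟩
      have hR := In_sub_R z h1
      exact ⟨h1, (foldS hK hR.1.le hR.2.1.le).1 h2⟩
  have hbB : Bornology.IsBounded B := bdd_In.subset Set.inter_subset_left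
  have hl : LipschitzWith 1 rh := LipschitzWith.of_dist_le_mul fun x y => by
    rw [dist_rh]; simp
  have hb1 := hl.isBounded_image hbB
  have hb2 := hl.isBounded_image hb1
  have hBW : ∀ z ∈ B, 0 < z.re + Yc z ∧ 0 < 1 - z.re + Yc z := fun z hz =>
    ⟨(In_sub_R z hz.1).1, (In_sub_R z hz.1).2.1⟩
  have e : volume.real (UU ∩ nb (Sn K) ε) = volume.real (B ∪ (rh '' B ∪ rh '' (rh '' B))) := by
    apply measureReal_congr
    have n1 : {z : ℂ | 1 * z.re + 1 * Yc z = 0}ᶜ ∈ ae (volume : Measure ℂ) :=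
      compl_mem_ae_iff.2 (line_null _ _ _ (Or.inl one_ne_zero))
    have n2 : {z : ℂ | (-1) * z.re + 1 * Yc z = -1}ᶜ ∈ ae (volume : Measure ℂ) :=
      compl_mem_ae_iff.2 (line_null _ _ _ (Or.inr one_ne_zero))
    have n3 : {z : ℂ | 1 * z.re + 0 * Yc z = 1 / 2}ᶜ ∈ ae (volume : Measure ℂ) :=
      compl_mem_ae_iff.2 (line_null _ _ _ (Or.inl one_ne_zero))
    filter_upwards [n1, n2, n3] with z z1 z2 z3
    have z1' : z.re + Yc z ≠ 0 := fun h => z1 (by show 1 * z.re + 1 * Yc z = 0; linarith)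
    have z2' : 1 - z.re + Yc z ≠ 0 := fun h => z2 (by show (-1) * z.re + 1 * Yc z = -1; linarith)
    have z3' : z.re - 1 / 2 ≠ 0 := fun h => z3 (by show 1 * z.re + 0 * Yc z = 1 / 2; linarith)
    apply propext
    have deW : ∀ w ∈ De, 0 < w.re + Yc w → 0 < 1 - w.re + Yc w → w ∈ In := fun w hw h1 h2 =>
      M_sub_In ⟨h1, h2, Or.inl hw.1⟩
    constructor
    · rintro ⟨h, hn⟩
      rcases h with h | (h | ⟨k, hk, rfl⟩) | ⟨_, ⟨k, hk, rfl⟩, rfl⟩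
      · by_cases c0 : 0 < z.re + Yc z ∧ 0 < 1 - z.re + Yc z
        · left; exact (hBS z).2 ⟨deW z h c0.1 c0.2, hn⟩
        by_cases c1 : 0 < (rh z).re + Yc (rh z) ∧ 0 < 1 - (rh z).re + Yc (rh z)
        · right; right
          exact ⟨_, ⟨rh z, (hBS _).2 ⟨deW _ (De_rh h) c1.1 c1.2, nbS_rh hn⟩, rfl⟩, rh3 z⟩
        · right; left
          refine ⟨rh (rh z), (hBS _).2 ⟨deW _ (De_rh (De_rh h)) ?_ ?_, nbS_rh (nbS_rh hn)⟩, rh3 z⟩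
          all_goals
            rw [not_and_or, not_lt, not_lt] at c0 c1
            simp only [rh_re, rh_Y] at *
            rcases lt_or_gt_of_ne z1' with z1 | z1 <;> rcases lt_or_gt_of_ne z2' with z2 | z2 <;>
            rcases lt_or_gt_of_ne z3' with z3 | z3 <;>
            rcases c0 with c0 | c0 <;> rcases c1 with c1 | c1 <;> linarith
      · left; exact (hBS z).2 ⟨h, hn⟩
      · right; left
        refine ⟨k, (hBS k).2 ⟨hk, ?_⟩, rfl⟩
        have := nbS_rh (nbS_rh hn); rwa [rh3] at this
      · right; right
        refine ⟨_, ⟨k, (hBS k).2 ⟨hk, ?_⟩, rfl⟩, rfl⟩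
        have := nbS_rh hn; rwa [rh3] at this
    · rintro (h | ⟨k, hk, rfl⟩ | ⟨_, ⟨k, hk, rfl⟩, rfl⟩)
      · exact ⟨Or.inr (Or.inl (Or.inl h.1)), ((hBS z).1 h).2⟩
      · exact ⟨Or.inr (Or.inl (Or.inr ⟨k, hk.1, rfl⟩)), nbS_rh ((hBS k).1 hk).2⟩
      · exact ⟨Or.inr (Or.inr ⟨_, ⟨k, hk.1, rfl⟩, rfl⟩), nbS_rh (nbS_rh ((hBS k).1 hk).2)⟩
  have d1 : Disjoint (rh '' B) (rh '' (rh '' B)) := by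
    rw [Set.disjoint_left]
    rintro _ ⟨y, hy, rfl⟩ ⟨_, ⟨x, hx, rfl⟩, he⟩
    rw [← rh.injective he] at hy
    have h1 := hBW _ hy; have h2 := hBW _ hx
    simp only [rh_re, rh_Y] at h1; linarith
  have d2 : Disjoint B (rh '' B ∪ rh '' (rh '' B)) := by
    rw [Set.disjoint_left]
    rintro z hz (⟨y, hy, rfl⟩ | ⟨_, ⟨x, hx, rfl⟩, rfl⟩)
    · have h1 := hBW _ hy; have h2 := hBW _ hz
      simp only [rh_re, rh_Y] at h2; linarith
    · have h1 := hBW _ hx; have h2 := hBW _ hz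
      simp only [rh_re, rh_Y] at h2; linarith
  rw [e, measureReal_union d2 ((meas_rh hBm).union (meas_rh (meas_rh hBm))) hbB.measure_lt_top.ne
    (hb1.union hb2).measure_lt_top.ne, measureReal_union d1 (meas_rh (meas_rh hBm))
    hb1.measure_lt_top.ne hb2.measure_lt_top.ne, vol_rh, vol_rh, vol_rh]
  unfold fIn
  ring

lemma tube_eq {K : Set ℂ} (hK : IsK K) {Ω : Set ℂ} (hb : Bornology.IsBounded Ω)
    (hΩ : ∃ x ∈ (Sn K)ᶜ, Ω = connectedComponentIn (Sn K)ᶜ x) (ε : ℝ) :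
    (volume {x ∈ Ω | infDist x (frontier Ω) ≤ ε}).toReal = 3 * fIn K ε := by
  rw [← vol_UU hK]
  have hU := Omega_eq hK hb hΩ
  have hopen : IsOpen Ω := by
    obtain ⟨x, hx, rfl⟩ := hΩ
    exact (cpt_S hK).isClosed.isOpen_compl.connectedComponentIn
  have hfr : frontier Ω ⊆ Sn K := by
    intro y hy
    by_contra hyS
    obtain ⟨x, hx, rfl⟩ := hΩ
    set C := connectedComponentIn (Sn K)ᶜ x
    have hp : IsPreconnected (insert y C) :=
      isPreconnected_connectedComponentIn.subset_closure (Set.subset_insert _ _)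
        (Set.insert_subset hy.1 subset_closure)
    have hs : insert y C ⊆ C := hp.subset_connectedComponentIn
      (Set.mem_insert_of_mem _ (mem_connectedComponentIn hx))
      (Set.insert_subset hyS (connectedComponentIn_subset _ _))
    have : y ∈ C := hs (Set.mem_insert _ _)
    rw [hopen.frontier_eq] at hy
    exact hy.2 this
  have hdis : ∀ k ∈ Sn K, k ∉ Ω := fun k hk hkΩ => UU_nS hK (hU ▸ hkΩ) hk
  obtain ⟨s, hs⟩ := ne_S hK
  have hne : Ω ≠ Set.univ := fun h => hdis s hs (h ▸ Set.mem_univ s)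
  have : {x ∈ Ω | infDist x (frontier Ω) ≤ ε} = UU ∩ nb (Sn K) ε := by
    rw [← hU]
    ext x
    constructor
    · rintro ⟨hx, hd⟩
      have hfn : (frontier Ω).Nonempty := nonempty_frontier_iff.2 ⟨⟨x, hx⟩, hne⟩
      obtain ⟨y, hy, he⟩ := isClosed_frontier.exists_infDist_eq_dist hfn x
      exact ⟨hx, y, hfr hy, he ▸ hd⟩
    · rintro ⟨hx, k, hk, hd⟩
      refine ⟨hx, ?_⟩
      obtain ⟨y, hy, he⟩ := exists_mem_frontier_infDist_compl_eq_dist hx hne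
      have h1 := infDist_le_dist_of_mem (x := x) hy
      have h2 : infDist x Ωᶜ ≤ dist x k := infDist_le_dist_of_mem (hdis k hk)
      linarith
  rw [this]; rfl

lemma ext_per (g : ℝ → ℝ) {e M : ℝ} (he : 0 < e)
    (hb : ∀ ε, e / 3 ≤ ε → ε ≤ e → |g ε| ≤ M)
    (hp : ∀ ε, 0 < ε → ε ≤ e → g (ε / 3) = g ε) :
    ∃ G : ℝ → ℝ, (∀ ε, 0 < ε → |G ε| ≤ M) ∧ (∀ ε, 0 < ε → G (3 * ε) = G ε) ∧
      ∀ ε, 0 < ε → ε ≤ e → G ε = g ε := by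
  have hit : ∀ (n : ℕ) (ε : ℝ), 0 < ε → ε * 3 ^ n ≤ e → g (ε * 3 ^ n) = g ε := by
    intro n
    induction n with
    | zero => intro ε _ _; simp
    | succ n ih =>
      intro ε h0 h1
      have h2 : 0 < ε * 3 ^ (n + 1) := by positivity
      have h3 : ε * 3 ^ (n + 1) / 3 = ε * 3 ^ n := by rw [pow_succ]; ring
      rw [← hp _ h2 h1, h3]
      apply ih ε h0
      rw [← h3]; linarith
  have key : ∀ ε, 0 < ε → e / 3 ≤ ε * 3 ^ (-⌈Real.logb 3 (ε / e)⌉) ∧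
      ε * 3 ^ (-⌈Real.logb 3 (ε / e)⌉) ≤ e := by
    intro ε h0
    have hq : 0 < ε / e := by positivity
    have e1 : ε = e * (3 : ℝ) ^ (Real.logb 3 (ε / e)) := by
      rw [Real.rpow_logb (by norm_num) (by norm_num) hq]; field_simp
    have e2 : ε * 3 ^ (-⌈Real.logb 3 (ε / e)⌉) =
        e * (3 : ℝ) ^ (Real.logb 3 (ε / e) - (⌈Real.logb 3 (ε / e)⌉ : ℝ)) := by
      rw [Real.rpow_sub (by norm_num), Real.rpow_intCast, zpow_neg, ← mul_div_assoc, ← e1]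
      exact (div_eq_mul_inv _ _).symm
    rw [e2]
    have l1 := Int.le_ceil (Real.logb 3 (ε / e))
    have l2 := Int.ceil_lt_add_one (Real.logb 3 (ε / e))
    constructor
    · have : (3 : ℝ) ^ (-1 : ℝ) ≤ 3 ^ (Real.logb 3 (ε / e) - (⌈Real.logb 3 (ε / e)⌉ : ℝ)) :=
        Real.rpow_le_rpow_of_exponent_le (by norm_num) (by linarith)
      rw [Real.rpow_neg_one] at this
      have := mul_le_mul_of_nonneg_left this he.le
      rwa [div_eq_mul_inv]
    · have : (3 : ℝ) ^ (Real.logb 3 (ε / e) - (⌈Real.logb 3 (ε / e)⌉ : ℝ)) ≤ 1 :=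
        Real.rpow_le_one_of_one_le_of_nonpos (by norm_num) (by linarith)
      nlinarith
  refine ⟨fun ε => g (ε * 3 ^ (-⌈Real.logb 3 (ε / e)⌉)), fun ε h0 => ?_, fun ε h0 => ?_,
    fun ε h0 h1 => ?_⟩
  · exact hb _ (key ε h0).1 (key ε h0).2
  · have : Real.logb 3 (3 * ε / e) = Real.logb 3 (ε / e) + 1 := by
      rw [mul_div_assoc, Real.logb_mul (by norm_num) (by positivity),
        Real.logb_self_eq_one (by norm_num), add_comm]
    show g _ = g _
    congr 1
    rw [this, Int.ceil_add_one, neg_add, zpow_add₀ (by norm_num), zpow_neg_one]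
    ring
  · have hn : ⌈Real.logb 3 (ε / e)⌉ ≤ 0 := by
      rw [Int.ceil_le, Int.cast_zero]
      exact Real.logb_nonpos (by norm_num) (by positivity) ((div_le_one he).2 h1)
    obtain ⟨m, hm⟩ := Int.eq_ofNat_of_zero_le (neg_nonneg.2 hn)
    have hk := (key ε h0).2
    show g _ = g _
    rw [hm, zpow_natCast] at hk ⊢
    exact hit m ε h0 hk

lemma s3le : Real.sqrt 3 ≤ 2 := by
  rw [Real.sqrt_le_left (by norm_num)]; norm_num

lemma pow3 {D : ℝ} (hD : D = Real.log 4 / Real.log 3) : (3 : ℝ) ^ (2 - D) = 9 / 4 := by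
  have h3 : Real.log 3 ≠ 0 := (Real.log_pos (by norm_num)).ne'
  have : (3 : ℝ) ^ D = 4 := by
    rw [Real.rpow_def_of_pos (by norm_num), hD, mul_div_cancel₀ _ h3, Real.exp_log (by norm_num)]
  rw [Real.rpow_sub (by norm_num), this]; norm_num

lemma final {K : Set ℂ} (hK : IsK K) {D : ℝ} (hD : D = Real.log 4 / Real.log 3) :
    ∃ ε₀ : ℝ, 0 < ε₀ ∧ ∃ G₁ G₂ : ℝ → ℝ,
      (∃ M : ℝ, ∀ ε : ℝ, 0 < ε → |G₁ ε| ≤ M ∧ |G₂ ε| ≤ M) ∧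
      (∀ ε : ℝ, 0 < ε → G₁ (3 * ε) = G₁ ε ∧ G₂ (3 * ε) = G₂ ε) ∧
      ∀ ε : ℝ, 0 < ε → ε ≤ ε₀ → 3 * fIn K ε = G₁ ε * ε ^ (2 - D) + G₂ ε * ε ^ 2 := by
  set F : ℝ → ℝ := fun ε => fw K (Real.sqrt 3 * ε) with hF
  have hFp : ∀ ε, 0 < ε → ε ≤ 1 / 100 → F (ε / 3) = 1 / 9 * F ε := by
    intro ε h0 h1
    rw [hF]
    show fw K (Real.sqrt 3 * (ε / 3)) = _
    rw [← mul_div_assoc]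
    exact fw_eq hK (mul_pos s3pos h0) (by nlinarith [s3le])
  have hIn : ∀ ε, fIn K ε = 4 / 9 * fIn K (3 * ε) + 4 / 3 * F ε := by
    intro ε
    rw [fIn_eq hK, fA_eq hK, ← mul_assoc, s3sq]
    show _ = 4 / 9 * fIn K (3 * ε) + 4 / 3 * fw K (Real.sqrt 3 * ε)
    ring
  have hFb : ∃ a, ∀ ε, 0 ≤ F ε ∧ F ε ≤ a :=
    ⟨volume.real X, fun ε => ⟨measureReal_nonneg, measureReal_mono Set.inter_subset_left
      bdd_X.measure_lt_top.ne⟩⟩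
  have hIb : ∃ a, ∀ ε, 0 ≤ fIn K ε ∧ fIn K ε ≤ a :=
    ⟨volume.real In, fun ε => ⟨measureReal_nonneg, measureReal_mono Set.inter_subset_left
      bdd_In.measure_lt_top.ne⟩⟩
  obtain ⟨a, ha⟩ := hFb
  obtain ⟨b, hb⟩ := hIb
  have ha0 : 0 ≤ a := (ha 0).1.trans (ha 0).2
  have hb0 : 0 ≤ b := (hb 0).1.trans (hb 0).2
  have h2D : 0 ≤ 2 - D := by
    by_contra h
    have h1 := Real.rpow_le_one_of_one_le_of_nonpos (x := 3) (by norm_num) (not_le.1 h).le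
    rw [pow3 hD] at h1; norm_num at h1
  have he : (0 : ℝ) < 1 / 100 := by norm_num
  have hc : 0 < ((1 / 100 / 3 : ℝ)) ^ (2 - D) := by positivity
  obtain ⟨G₁, b1, q1, v1⟩ := ext_per
    (fun ε => (3 * fIn K ε + 4 / 3 * F ε) / ε ^ (2 - D))
    (M := (3 * b + 4 / 3 * a) / (1 / 100 / 3) ^ (2 - D)) he
    (by
      intro ε h1 h2
      have h0 : 0 < ε := by linarith
      have h3 := ha ε; have h4 := hb ε
      rw [abs_of_nonneg (div_nonneg (by linarith) (by positivity))]
      exact div_le_div₀ (by linarith) (by linarith) hc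
        (Real.rpow_le_rpow (by norm_num) h1 h2D))
    (by
      intro ε h0 h1
      show (3 * fIn K (ε / 3) + 4 / 3 * F (ε / 3)) / (ε / 3) ^ (2 - D) = _ / _
      rw [hIn (ε / 3), hFp ε h0 h1, Real.div_rpow h0.le (by norm_num), pow3 hD,
        mul_div_cancel₀ ε (by norm_num : (3 : ℝ) ≠ 0)]
      have : 0 < ε ^ (2 - D) := by positivity
      field_simp
      ring)
  obtain ⟨G₂, b2, q2, v2⟩ := ext_per
    (fun ε => -(4 / 3 * F ε) / ε ^ 2)
    (M := (4 / 3 * a) / (1 / 100 / 3) ^ 2) he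
    (by
      intro ε h1 h2
      have h0 : 0 < ε := by linarith
      have h3 := ha ε
      rw [neg_div, abs_neg, abs_of_nonneg (div_nonneg (by linarith) (by positivity))]
      exact div_le_div₀ (by linarith) (by linarith) (by norm_num)
        (pow_le_pow_left₀ (by norm_num) h1 2))
    (by
      intro ε h0 h1
      show -(4 / 3 * F (ε / 3)) / (ε / 3) ^ 2 = _ / _
      rw [hFp ε h0 h1]
      field_simp
      ring)
  refine ⟨1 / 100, he, G₁, G₂, ⟨_, fun ε h => ⟨(b1 ε h).trans (le_max_left _ _),
    (b2 ε h).trans (le_max_right _ _)⟩⟩, fun ε h => ⟨q1 ε h, q2 ε h⟩, fun ε h0 h1 => ?_⟩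
  rw [v1 ε h0 h1, v2 ε h0 h1]
  have : 0 < ε ^ (2 - D) := by positivity
  field_simp
  ring

lemma exp_val : Complex.exp (2 * Real.pi * Complex.I / 3) = ⟨-1 / 2, Real.sqrt 3 / 2⟩ := by
  have h : (2 * Real.pi * Complex.I / 3 : ℂ) = ((2 * Real.pi / 3 : ℝ) : ℂ) * Complex.I := by
    push_cast; ring
  have e : 2 * Real.pi / 3 = Real.pi - Real.pi / 3 := by ring
  rw [h, Complex.exp_mul_I, ← Complex.ofReal_cos, ← Complex.ofReal_sin, e, Real.cos_pi_sub,
    Real.sin_pi_sub, Real.cos_pi_div_three, Real.sin_pi_div_three]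
  apply Complex.ext <;> simp <;> norm_num

lemma xi_val : (1 / 2 + Complex.I / (2 * Real.sqrt 3) : ℂ) = ⟨1 / 2, Real.sqrt 3 / 6⟩ := by
  have h : (1 / 2 + Complex.I / (2 * Real.sqrt 3) : ℂ) =
      ((1 / 2 : ℝ) : ℂ) + ((Real.sqrt 3 / 6 : ℝ) : ℂ) * Complex.I := by
    have h1 : (Real.sqrt 3 : ℂ) ≠ 0 := by exact_mod_cast s3pos.ne'
    have h2 : (Real.sqrt 3 : ℂ) * (Real.sqrt 3 : ℂ) = 3 := by exact_mod_cast s3sq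
    push_cast
    field_simp
    linear_combination (-2 * Complex.I) * h2
  rw [h]
  apply Complex.ext <;> simp

lemma c_val : (1 / 2 - Complex.I * Real.sqrt 3 / 6 : ℂ) = ⟨1 / 2, -(Real.sqrt 3 / 6)⟩ := by
  have h : (1 / 2 - Complex.I * Real.sqrt 3 / 6 : ℂ) =
      ((1 / 2 : ℝ) : ℂ) + ((-(Real.sqrt 3 / 6) : ℝ) : ℂ) * Complex.I := by
    push_cast; ring
  rw [h]
  apply Complex.ext <;> simp

end
end KochTube

/-- Tube formula for the Koch snowflake domain `Ω` (identifying
`ℝ²` with `ℂ`).  The Koch curve `K` is the attractor of `φ₁(z) = ξ·conj(z)` and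
`φ₂(z) = (1−ξ)(conj(z)−1)+1` with `ξ = 1/2 + i/(2√3)`; the snowflake curve is
`S = K ∪ ρ(K) ∪ ρ²(K)` where `ρ` is rotation by `2π/3` about `c = 1/2 − i√3/6`,
and `Ω` is the bounded connected component of `ℂ \ S`.  With `D = log 4 / log 3`,
there exist `ε₀ > 0` and bounded functions `G₁, G₂ : (0,∞) → ℝ` with
`G_i(3ε) = G_i(ε)` for all `ε > 0`, such that for all `0 < ε ≤ ε₀` the area of
`{x ∈ Ω : dist(x, ∂Ω) ≤ ε}` equals `G₁(ε) ε^{2−D} + G₂(ε) ε²`. -/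
theorem stmt_7 (ξ c : ℂ) (hξ : ξ = 1 / 2 + Complex.I / (2 * Real.sqrt 3))
    (hc : c = 1 / 2 - Complex.I * Real.sqrt 3 / 6)
    (φ₁ φ₂ ρ : ℂ → ℂ)
    (hφ₁ : ∀ z, φ₁ z = ξ * (starRingEnd ℂ) z)
    (hφ₂ : ∀ z, φ₂ z = (1 - ξ) * ((starRingEnd ℂ) z - 1) + 1)
    (hρ : ∀ z, ρ z = Complex.exp (2 * Real.pi * Complex.I / 3) * (z - c) + c)
    (K : Set ℂ) (hKne : K.Nonempty) (hKc : IsCompact K)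
    (hK : K = φ₁ '' K ∪ φ₂ '' K)
    (S : Set ℂ) (hS : S = K ∪ ρ '' K ∪ ρ '' (ρ '' K))
    (Ω : Set ℂ) (hΩbdd : Bornology.IsBounded Ω)
    (hΩ : ∃ x ∈ Sᶜ, Ω = connectedComponentIn Sᶜ x)
    (D : ℝ) (hD : D = Real.log 4 / Real.log 3) :
    ∃ ε₀ : ℝ, 0 < ε₀ ∧ ∃ G₁ G₂ : ℝ → ℝ,
      (∃ M : ℝ, ∀ ε : ℝ, 0 < ε → |G₁ ε| ≤ M ∧ |G₂ ε| ≤ M) ∧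
      (∀ ε : ℝ, 0 < ε → G₁ (3 * ε) = G₁ ε ∧ G₂ (3 * ε) = G₂ ε) ∧
      ∀ ε : ℝ, 0 < ε → ε ≤ ε₀ →
        (volume {x ∈ Ω | infDist x (frontier Ω) ≤ ε}).toReal
          = G₁ ε * ε ^ (2 - D) + G₂ ε * ε ^ 2 := by
  have s := KochTube.s3sq
  rw [KochTube.xi_val] at hξ
  rw [KochTube.c_val] at hc
  have e1 : φ₁ = KochTube.p1 := by
    funext z
    apply KochTube.ext_co
    · rw [hφ₁, hξ, KochTube.p1_re, KochTube.Yc, Complex.mul_re, Complex.conj_re, Complex.conj_im]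
      ring
    · rw [hφ₁, hξ, KochTube.p1_Y, KochTube.Yc, KochTube.Yc, Complex.mul_im, Complex.conj_re,
        Complex.conj_im]
      linear_combination z.re / 6 * s
  have e2 : φ₂ = KochTube.p2 := by
    funext z
    apply KochTube.ext_co
    · rw [hφ₂, hξ, KochTube.p2_re, KochTube.Yc]
      simp only [Complex.mul_re, Complex.conj_re, Complex.conj_im, Complex.add_re, Complex.sub_re,
        Complex.sub_im, Complex.one_re, Complex.one_im]
      ring
    · rw [hφ₂, hξ, KochTube.p2_Y, KochTube.Yc, KochTube.Yc]
      simp only [Complex.mul_im, Complex.conj_re, Complex.conj_im, Complex.add_im, Complex.sub_re,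
        Complex.sub_im, Complex.one_re, Complex.one_im]
      linear_combination (1 - z.re) / 6 * s
  have e3 : ρ = KochTube.rh := by
    funext z
    apply KochTube.ext_co
    · rw [hρ, hc, KochTube.exp_val, KochTube.rh_re, KochTube.Yc]
      simp only [Complex.mul_re, Complex.add_re, Complex.sub_re, Complex.sub_im]
      linear_combination (-1 / 12) * s
    · rw [hρ, hc, KochTube.exp_val, KochTube.rh_Y, KochTube.Yc, KochTube.Yc]
      simp only [Complex.mul_im, Complex.add_im, Complex.sub_re, Complex.sub_im]
      linear_combination (z.re / 2 - 1 / 2) * s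
  subst e1 e2 e3
  have hI : KochTube.IsK K := ⟨hKne, hKc, hK⟩
  have hS' : S = KochTube.Sn K := hS
  subst hS'
  obtain ⟨e, he, G₁, G₂, h1, h2, h3⟩ := KochTube.final hI hD
  refine ⟨e, he, G₁, G₂, h1, h2, fun ε h0 hle => ?_⟩
  rw [KochTube.tube_eq hI hΩbdd hΩ, h3 ε h0 hle]
end

section
/- Let A ⊆ ℝ^d be a nonempty compact convex set and B^d the closed unit ball of ℝ^d. Then there exist nonnegative real numbers c_0, c_1, …, c_d, with c_d = vol_d(A), such that for every ε ≥ 0, vol_d(A + εB^d) = ∑_{i=0}^{d} c_i ε^{d−i}, where A + εB^d = {a + εb : a ∈ A, b ∈ B^d} is the Minkowski sum. -/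
open MeasureTheory Pointwise

open Polynomial in
lemma steiner_det {d : ℕ} (L : EuclideanSpace ℝ (Fin d) →L[ℝ] EuclideanSpace ℝ (Fin d))
    (hs : ∀ v w, inner ℝ (L v) w = inner ℝ v (L w))
    (h0 : ∀ v, 0 ≤ inner ℝ (L v) v) (h1 : ∀ v, inner ℝ (L v) v ≤ ‖v‖ ^ 2) :
    ∃ q : ℝ[X], q.natDegree ≤ d ∧ (∀ i, 0 ≤ q.coeff i) ∧
      ∀ t : ℝ, q.eval t =
        ((1 - t) • L + t • ContinuousLinearMap.id ℝ (EuclideanSpace ℝ (Fin d))).det := by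
  have hT : (L : EuclideanSpace ℝ (Fin d) →ₗ[ℝ] EuclideanSpace ℝ (Fin d)).IsSymmetric := hs
  have hn : Module.finrank ℝ (EuclideanSpace ℝ (Fin d)) = d := by simp
  set b := hT.eigenvectorBasis hn with hb
  set l := hT.eigenvalues hn with hl
  have hLb : ∀ i, L (b i) = l i • b i := fun i =>
    hT.apply_eigenvectorBasis hn i
  have hin : ∀ i, inner ℝ (L (b i)) (b i) = l i := fun i => by
    rw [hLb, real_inner_smul_left, real_inner_self_eq_norm_sq, b.norm_eq_one]; simp
  have hl0 : ∀ i, 0 ≤ l i := fun i => by rw [← hin]; exact h0 _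
  have hl1 : ∀ i, l i ≤ 1 := fun i => by
    rw [← hin]; refine (h1 _).trans ?_; rw [b.norm_eq_one]; simp
  refine ⟨∏ i, (C (1 - l i) * X + C (l i)), ?_, ?_, ?_⟩
  · refine (natDegree_prod_le _ _).trans ?_
    refine (Finset.sum_le_sum (g := fun _ => 1) fun i _ => natDegree_linear_le).trans ?_
    simp
  · suffices H : ∀ s : Finset (Fin d), ∀ k, 0 ≤ (∏ i ∈ s, (C (1 - l i) * X + C (l i))).coeff k from
      H _
    intro s
    induction s using Finset.induction_on with
    | empty => intro k; simp [coeff_one]; split_ifs <;> norm_num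
    | insert a s ha ih =>
      intro k
      rw [Finset.prod_insert ha, coeff_mul]
      refine Finset.sum_nonneg fun x _ => mul_nonneg ?_ (ih _)
      simp only [coeff_add, coeff_C_mul, coeff_X, coeff_C]
      have := hl0 a
      have := hl1 a
      split_ifs <;> simp <;> linarith
  · intro t
    rw [eval_prod, ContinuousLinearMap.det, ← LinearMap.det_toMatrix b.toBasis]
    have : LinearMap.toMatrix b.toBasis b.toBasis
        (((1 - t) • L + t • ContinuousLinearMap.id ℝ (EuclideanSpace ℝ (Fin d)) :
          EuclideanSpace ℝ (Fin d) →L[ℝ] EuclideanSpace ℝ (Fin d)) :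
          EuclideanSpace ℝ (Fin d) →ₗ[ℝ] EuclideanSpace ℝ (Fin d)) =
        Matrix.diagonal fun i => (1 - t) * l i + t := by
      ext i j
      rw [LinearMap.toMatrix_apply]
      simp only [OrthonormalBasis.coe_toBasis, ContinuousLinearMap.coe_coe,
        add_apply, smul_apply, hLb,
        ContinuousLinearMap.id_apply, smul_smul,
        ← add_smul, map_smul]
      simp [Matrix.diagonal_apply]
      by_cases hij : i = j
      · subst hij; rfl
      · rw [if_neg hij, if_neg hij]
    rw [this, Matrix.det_diagonal]
    refine Finset.prod_congr rfl fun i _ => ?_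
    simp
    ring

lemma steiner_null {d : ℕ} (f : EuclideanSpace ℝ (Fin d) → EuclideanSpace ℝ (Fin d))
    (K : NNReal) (hf : LipschitzWith K f) (s : Set (EuclideanSpace ℝ (Fin d)))
    (h : volume s = 0) : volume (f '' s) = 0 := by
  let μ : Measure (EuclideanSpace ℝ (Fin d)) :=
    Measure.hausdorffMeasure (Module.finrank ℝ (EuclideanSpace ℝ (Fin d)))
  have h1 : μ s = 0 := Measure.absolutelyContinuous_isAddHaarMeasure μ volume h
  apply Measure.absolutelyContinuous_isAddHaarMeasure volume μ
  refine le_antisymm ((hf.hausdorffMeasure_image_le (by positivity) s).trans ?_) bot_le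
  change _ * μ s ≤ 0
  simp [h1]

/-- `p` is the metric projection on `A`. -/
structure SteinerProj {d : ℕ} (A : Set (EuclideanSpace ℝ (Fin d)))
    (p : EuclideanSpace ℝ (Fin d) → EuclideanSpace ℝ (Fin d)) : Prop where
  mem : ∀ x, p x ∈ A
  le : ∀ x, ∀ w ∈ A, inner ℝ (x - p x) (w - p x) ≤ 0

namespace SteinerProj
variable {d : ℕ} {A : Set (EuclideanSpace ℝ (Fin d))}
    {p : EuclideanSpace ℝ (Fin d) → EuclideanSpace ℝ (Fin d)}

lemma firm (h : SteinerProj A p) (x y) : ‖p x - p y‖ ^ 2 ≤ inner ℝ (p x - p y) (x - y) := by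
  have h1 := h.le x (p y) (h.mem y)
  have h2 := h.le y (p x) (h.mem x)
  rw [← real_inner_self_eq_norm_sq]
  have e : inner ℝ (p x - p y) (x - y) - inner ℝ (p x - p y) (p x - p y)
    = - inner ℝ (x - p x) (p y - p x) - inner ℝ (y - p y) (p x - p y) := by
    simp only [inner_sub_left, inner_sub_right]
    simp only [real_inner_comm]
    ring
  linarith

lemma lip (h : SteinerProj A p) (x y) : ‖p x - p y‖ ≤ ‖x - y‖ := by
  have h1 := h.firm x y
  have h2 := real_inner_le_norm (p x - p y) (x - y)
  by_contra! hc
  have := norm_nonneg (x - y)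
  nlinarith

lemma lipschitz (h : SteinerProj A p) : LipschitzWith 1 p :=
  LipschitzWith.of_dist_le_mul fun x y => by simpa [dist_eq_norm] using h.lip x y

lemma uniq (h : SteinerProj A p) {x z} (hz : z ∈ A) (hx : ∀ w ∈ A, inner ℝ (x - z) (w - z) ≤ 0) :
    p x = z := by
  have h1 := h.le x z hz
  have h2 := hx (p x) (h.mem x)
  have e : inner ℝ (x - p x) (z - p x) + inner ℝ (x - z) (p x - z) = ‖p x - z‖ ^ 2 := by
    rw [← real_inner_self_eq_norm_sq]
    simp only [inner_sub_left, inner_sub_right]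
    simp only [real_inner_comm]
    ring
  have : ‖p x - z‖ = 0 := by
    have := sq_nonneg ‖p x - z‖
    exact pow_eq_zero_iff (two_ne_zero) |>.1 (by linarith)
  exact sub_eq_zero.1 (norm_eq_zero.1 this)

lemma ray (h : SteinerProj A p) (x) {t : ℝ} (ht : 0 ≤ t) : p (p x + t • (x - p x)) = p x := by
  apply h.uniq (h.mem x)
  intro w hw
  rw [add_sub_cancel_left, real_inner_smul_left]
  exact mul_nonpos_of_nonneg_of_nonpos ht (h.le x w hw)

lemma fix (h : SteinerProj A p) {x} (hx : x ∈ A) : p x = x :=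
  h.uniq hx (by simp)

lemma closest (h : SteinerProj A p) (x) {a} (ha : a ∈ A) : ‖x - p x‖ ≤ ‖x - a‖ := by
  have h1 := h.le x a ha
  have e : ‖x - a‖ ^ 2 = ‖x - p x‖ ^ 2 - 2 * inner ℝ (x - p x) (a - p x) + ‖a - p x‖ ^ 2 := by
    rw [← norm_sub_sq_real]; congr 2; abel
  have := sq_nonneg ‖a - p x‖
  exact le_of_sq_le_sq (by linarith) (norm_nonneg _)

lemma parallel (h : SteinerProj A p) {t : ℝ} (ht : 0 ≤ t) :
    A + t • Metric.closedBall (0 : EuclideanSpace ℝ (Fin d)) 1 = {x | ‖x - p x‖ ≤ t} := by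
  rw [smul_unitClosedBall_of_nonneg ht]
  ext x
  constructor
  · rintro ⟨a, ha, b, hb, rfl⟩
    refine (h.closest _ ha).trans ?_
    simpa using hb
  · intro hx
    exact ⟨p x, h.mem x, x - p x, by simpa using hx, by simp⟩

lemma hasFDerivAt (h : SteinerProj A p) (x) :
    HasFDerivAt (fun y => inner ℝ y (p y) - ‖p y‖ ^ 2 / 2) (innerSL ℝ (p x)) x := by
  have key : ∀ y z, inner ℝ z (p y) - ‖p y‖ ^ 2 / 2 ≤ inner ℝ z (p z) - ‖p z‖ ^ 2 / 2 := by
    intro y z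
    have h1 := h.closest z (h.mem y)
    have h2 : ‖z - p z‖ ^ 2 ≤ ‖z - p y‖ ^ 2 := by gcongr
    rw [norm_sub_sq_real, norm_sub_sq_real] at h2
    linarith
  rw [hasFDerivAt_iff_isLittleO]
  have hO : (fun y => (inner ℝ y (p y) - ‖p y‖ ^ 2 / 2) - (inner ℝ x (p x) - ‖p x‖ ^ 2 / 2)
      - innerSL ℝ (p x) (y - x)) =O[nhds x] (fun y => ‖y - x‖ ^ 2) := by
    refine Asymptotics.IsBigO.of_bound 1 (Filter.Eventually.of_forall fun y => ?_)
    have h1 := key x y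
    have h2 := key y x
    have h3 := real_inner_le_norm (p y - p x) (y - x)
    have h4 : ‖p y - p x‖ * ‖y - x‖ ≤ ‖y - x‖ * ‖y - x‖ := by
      gcongr; exact h.lip y x
    have e1 : inner ℝ (p x) (y - x) = inner ℝ y (p x) - inner ℝ x (p x) := by
      rw [inner_sub_right, real_inner_comm, real_inner_comm (p x) x]
    have e2 : inner ℝ (p y - p x) (y - x) =
      inner ℝ y (p y) - inner ℝ x (p y) - (inner ℝ y (p x) - inner ℝ x (p x)) := by
      rw [← e1, inner_sub_left, inner_sub_right (p y), real_inner_comm, real_inner_comm (p y) x]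
    rw [innerSL_apply_apply, e1, Real.norm_of_nonneg (by linarith), Real.norm_of_nonneg (by positivity)]
    nlinarith
  refine hO.trans_isLittleO ?_
  have := (Asymptotics.isLittleO_pow_sub_sub x (m := 2) (by norm_num) :
    (fun y => ‖y - x‖ ^ 2) =o[nhds x] fun y => y - x)
  exact this

lemma symm (h : SteinerProj A p) {x} (hx : DifferentiableAt ℝ p x) (v w) :
    inner ℝ (fderiv ℝ p x v) w = inner ℝ v (fderiv ℝ p x w) := by
  have h2 : HasFDerivAt (fun y => innerSL ℝ (p y)) ((innerSL ℝ).comp (fderiv ℝ p x)) x :=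
    (innerSL ℝ (E := EuclideanSpace ℝ (Fin d))).hasFDerivAt.comp x hx.hasFDerivAt
  have := second_derivative_symmetric (fun y => h.hasFDerivAt y) h2 v w
  simp only [ContinuousLinearMap.comp_apply, innerSL_apply_apply] at this
  rw [this, real_inner_comm]

lemma nonneg (h : SteinerProj A p) {x} (hx : DifferentiableAt ℝ p x) (v) :
    0 ≤ inner ℝ (fderiv ℝ p x v) v := by
  have h1 := (hx.hasFDerivAt.hasLineDerivAt v).tendsto_slope_zero_right
  have h2 : Filter.Tendsto (fun t : ℝ => inner ℝ (t⁻¹ • (p (x + t • v) - p x)) v)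
    (nhdsWithin 0 (Set.Ioi 0)) (nhds (inner ℝ (fderiv ℝ p x v) v)) := by
    refine Filter.Tendsto.inner ?_ tendsto_const_nhds
    simpa using h1
  refine ge_of_tendsto h2 ?_
  filter_upwards [self_mem_nhdsWithin] with t ht
  have ht : 0 < t := ht
  have h3 := (sq_nonneg _).trans (h.firm (x + t • v) x)
  rw [add_sub_cancel_left, real_inner_smul_right] at h3
  rw [real_inner_smul_left]
  exact mul_nonneg (by positivity) (nonneg_of_mul_nonneg_right h3 ht)

lemma le_sq (h : SteinerProj A p) (x v) :
    inner ℝ (fderiv ℝ p x v) v ≤ ‖v‖ ^ 2 := by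
  have h1 := norm_fderiv_le_of_lipschitz ℝ h.lipschitz (x₀ := x)
  have h2 := (fderiv ℝ p x).le_of_opNorm_le h1 v
  have := real_inner_le_norm (fderiv ℝ p x v) v
  have := norm_nonneg v
  simp at h2
  nlinarith

lemma det_zero (h : SteinerProj A p) {x} (hx : DifferentiableAt ℝ p x) (hxA : x ∉ A) :
    (fderiv ℝ p x).det = 0 := by
  have hne : x - p x ≠ 0 := fun h0 => hxA (by rw [sub_eq_zero.1 h0]; exact h.mem x)
  have h0 : fderiv ℝ p x (x - p x) = 0 := by
    have h1 := (hx.hasFDerivAt.hasLineDerivAt (x - p x)).tendsto_slope_zero_right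
    refine tendsto_nhds_unique h1 (tendsto_const_nhds.congr' ?_)
    filter_upwards [self_mem_nhdsWithin] with t ht
    have ht : 0 < t := ht
    have := h.ray x (t := 1 + t) (by positivity)
    have e : p x + (1 + t) • (x - p x) = x + t • (x - p x) := by
      rw [add_smul, one_smul]; abel
    rw [e] at this
    simp [this]
  by_contra hd
  refine hne ((LinearMap.equivOfDetNeZero (fderiv ℝ p x).toLinearMap hd).injective ?_)
  rw [map_zero]
  exact h0

/-- The domain of integration. -/
def dom (A : Set (EuclideanSpace ℝ (Fin d)))
    (p : EuclideanSpace ℝ (Fin d) → EuclideanSpace ℝ (Fin d)) : Set (EuclideanSpace ℝ (Fin d)) :=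
  ({x | ‖x - p x‖ ≤ 1} \ A) ∩ {x | DifferentiableAt ℝ p x}

/-- The derivative of the scaling map. -/
noncomputable def jac (p : EuclideanSpace ℝ (Fin d) → EuclideanSpace ℝ (Fin d)) (t : ℝ)
    (x : EuclideanSpace ℝ (Fin d)) : EuclideanSpace ℝ (Fin d) →L[ℝ] EuclideanSpace ℝ (Fin d) :=
  (1 - t) • fderiv ℝ p x + t • ContinuousLinearMap.id ℝ (EuclideanSpace ℝ (Fin d))

lemma measurable_dom (h : SteinerProj A p) (hA : IsCompact A) : MeasurableSet (dom A p) := by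
  refine MeasurableSet.inter (MeasurableSet.diff ?_ hA.isClosed.measurableSet)
    (measurableSet_of_differentiableAt ℝ p)
  have := h.lipschitz.continuous
  exact (isClosed_le (by fun_prop) (by fun_prop)).measurableSet

lemma volume_parallel (h : SteinerProj A p) (hA : IsCompact A) {t : ℝ} (ht : 0 < t) :
    volume (A + t • Metric.closedBall (0 : EuclideanSpace ℝ (Fin d)) 1) =
      volume A + ∫⁻ x in dom A p, ENNReal.ofReal |(jac p t x).det| := by
  set F : EuclideanSpace ℝ (Fin d) → EuclideanSpace ℝ (Fin d) := fun x => p x + t • (x - p x)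
    with hF
  have hpF : ∀ x, p (F x) = p x := fun x => h.ray x ht.le
  have hinj : Function.Injective F := by
    intro x y hxy
    have h1 : p x = p y := by rw [← hpF x, hxy, hpF]
    simp only [hF, h1, add_right_inj] at hxy
    have := smul_right_injective _ ht.ne' hxy
    simpa using this
  have hlip : ∃ K, LipschitzWith K F := by
    refine ⟨_, h.lipschitz.add ((lipschitzWith_smul t).comp (LipschitzWith.id.sub h.lipschitz))⟩
  obtain ⟨K, hK⟩ := hlip
  have hder : ∀ x ∈ dom A p, HasFDerivWithinAt F (jac p t x) (dom A p) x := by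
    intro x hx
    have h1 : HasFDerivAt p (fderiv ℝ p x) x := hx.2.hasFDerivAt
    have h2 := h1.add (((hasFDerivAt_id x).sub h1).const_smul t)
    refine HasFDerivAt.hasFDerivWithinAt (h2.congr_fderiv ?_)
    ext1 v
    simp only [jac, add_apply, smul_apply, sub_apply, ContinuousLinearMap.id_apply]
    module
  rw [lintegral_abs_det_fderiv_eq_addHaar_image volume (h.measurable_dom hA) hder hinj.injOn]
  have himg : F '' ({x | ‖x - p x‖ ≤ 1} \ A) =
      (A + t • Metric.closedBall (0 : EuclideanSpace ℝ (Fin d)) 1) \ A := by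
    rw [h.parallel ht.le]
    have hFA : ∀ x, F x ∈ A ↔ x ∈ A := by
      intro x
      constructor
      · intro hx
        have h1 := h.fix hx
        rw [hpF] at h1
        have h2 : t • (x - p x) = 0 := by simpa [hF] using h1
        have h3 : x - p x = 0 := by simpa [ht.ne'] using h2
        rw [sub_eq_zero.1 h3]
        exact h.mem x
      · intro hx
        simpa [hF, h.fix hx] using hx
    have hn : ∀ x, ‖F x - p (F x)‖ = t * ‖x - p x‖ := by
      intro x
      rw [hpF]
      simp [hF, norm_smul, abs_of_pos ht]
    ext y
    constructor
    · rintro ⟨x, ⟨hx1, hx2⟩, rfl⟩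
      refine ⟨?_, fun hc => hx2 ((hFA x).1 hc)⟩
      have hx1 : ‖x - p x‖ ≤ 1 := hx1
      change ‖F x - p (F x)‖ ≤ t
      rw [hn]
      nlinarith
    · rintro ⟨hy1, hy2⟩
      have hx : F (p y + t⁻¹ • (y - p y)) = y := by
        simp only [hF]
        rw [h.ray y (by positivity), add_sub_cancel_left, smul_smul, mul_inv_cancel₀ ht.ne']
        simp
      refine ⟨_, ⟨?_, ?_⟩, hx⟩
      · have hy1 : ‖y - p y‖ ≤ t := hy1
        rw [← hx, hn] at hy1
        exact le_of_mul_le_mul_left (by simpa using hy1) ht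
      · intro hc
        exact hy2 (hx ▸ (hFA _).2 hc)
  have hAsub : A ⊆ A + t • Metric.closedBall (0 : EuclideanSpace ℝ (Fin d)) 1 := by
    rw [h.parallel ht.le]
    intro x hx
    simp [h.fix hx, ht.le]
  have h1 : volume (F '' dom A p) = volume (F '' ({x | ‖x - p x‖ ≤ 1} \ A)) := by
    refine le_antisymm (measure_mono (Set.image_mono Set.inter_subset_left)) ?_
    have h0 : volume (F '' {x | ¬ DifferentiableAt ℝ p x}) = 0 :=
      steiner_null F K hK _ (ae_iff.1 (h.lipschitz.ae_differentiableAt (μ := volume)))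
    have h2 : F '' ({x | ‖x - p x‖ ≤ 1} \ A) ⊆
        F '' dom A p ∪ F '' {x | ¬ DifferentiableAt ℝ p x} := by
      rw [← Set.image_union]
      refine Set.image_mono fun x hx => ?_
      by_cases hd : DifferentiableAt ℝ p x
      · exact Or.inl ⟨hx, hd⟩
      · exact Or.inr hd
    refine (measure_mono h2).trans ((measure_union_le _ _).trans ?_)
    rw [h0, add_zero]
  rw [h1, himg, ← measure_union Set.disjoint_sdiff_right
    (MeasurableSet.diff ?_ hA.isClosed.measurableSet), Set.union_sdiff_cancel hAsub]
  exact (hA.add ((isCompact_closedBall _ _).smul t)).isClosed.measurableSet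

open Polynomial in
lemma main (h : SteinerProj A p) (hA : IsCompact A) :
    ∃ c : Fin (d + 1) → ℝ,
      (∀ i, 0 ≤ c i) ∧
      c (Fin.last d) = (volume A).toReal ∧
      ∀ ε : ℝ, 0 ≤ ε →
        (volume (A + ε • Metric.closedBall (0 : EuclideanSpace ℝ (Fin d)) 1)).toReal
          = ∑ i : Fin (d + 1), c i * ε ^ (d - (i : ℕ)) := by
  have hq : ∀ x, ∃ q : ℝ[X], x ∈ dom A p → q.natDegree ≤ d ∧ (∀ i, 0 ≤ q.coeff i) ∧
      q.coeff 0 = 0 ∧ ∀ t : ℝ, q.eval t = (jac p t x).det := by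
    intro x
    by_cases hx : x ∈ dom A p
    · obtain ⟨q, h1, h2, h3⟩ := steiner_det (fderiv ℝ p x) (h.symm hx.2) (h.nonneg hx.2) (h.le_sq x)
      refine ⟨q, fun _ => ⟨h1, h2, ?_, h3⟩⟩
      rw [coeff_zero_eq_eval_zero, h3]
      have e : (1 - (0 : ℝ)) • fderiv ℝ p x +
          (0 : ℝ) • ContinuousLinearMap.id ℝ (EuclideanSpace ℝ (Fin d)) = fderiv ℝ p x := by
        ext1 v
        simp only [add_apply, smul_apply]
        module
      rw [e]
      exact h.det_zero hx.2 hx.1.2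
    · exact ⟨0, fun hc => absurd hc hx⟩
  choose q hq using hq
  have hdm := h.measurable_dom hA
  have hdet : ∀ t : ℝ, Measurable fun x => (jac p t x).det := by
    intro t
    refine ContinuousLinearMap.continuous_det.measurable.comp ?_
    exact ((measurable_fderiv ℝ p).const_smul (1 - t)).add_const _
  have hfin : ∀ t : ℝ, volume (A + t • Metric.closedBall (0 : EuclideanSpace ℝ (Fin d)) 1) ≠ ⊤ :=
    fun t => (hA.add ((isCompact_closedBall _ _).smul t)).measure_lt_top.ne
  have hint : ∀ t : ℝ, 0 < t → IntegrableOn (fun x => (jac p t x).det) (dom A p) := by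
    intro t ht
    refine ⟨(hdet t).aestronglyMeasurable, ?_⟩
    rw [hasFiniteIntegral_iff_norm]
    have h1 := hfin t
    rw [h.volume_parallel hA ht] at h1
    exact (ENNReal.add_ne_top.1 h1).2.lt_top
  let v : ℕ → ℝ := fun j => (j : ℝ) + 1
  have hv : Set.InjOn v (Finset.range (d + 1) : Finset ℕ) := fun a _ b _ hab => by
    simpa [v] using hab
  have hco : ∀ x ∈ dom A p, ∀ k, (q x).coeff k = ∑ j ∈ Finset.range (d + 1),
      (jac p (v j) x).det * (Lagrange.basis (Finset.range (d + 1)) v j).coeff k := by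
    intro x hx k
    obtain ⟨h1, -, -, h3⟩ := hq x hx
    have hdeg : (q x).degree < (Finset.range (d + 1)).card := by
      rw [Finset.card_range]
      exact (degree_le_of_natDegree_le h1).trans_lt (by exact_mod_cast Nat.lt_succ_self d)
    have := congrArg (fun r => coeff r k) (Lagrange.eq_interpolate hv hdeg)
    simp only [Lagrange.interpolate_apply, finsetSum_coeff, coeff_C_mul] at this
    rw [this]
    exact Finset.sum_congr rfl fun j _ => by rw [h3]
  have hcint : ∀ k, IntegrableOn (fun x => (q x).coeff k) (dom A p) := by
    intro k
    refine IntegrableOn.congr_fun (f := fun x => ∑ j ∈ Finset.range (d + 1),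
      (jac p (v j) x).det * (Lagrange.basis (Finset.range (d + 1)) v j).coeff k) ?_
      (fun x hx => (hco x hx k).symm) hdm
    refine integrable_finsetSum _ fun j _ => ?_
    exact (hint (v j) (by positivity)).mul_const _
  set m : ℕ → ℝ := fun k => ∫ x in dom A p, (q x).coeff k with hm
  have hm0 : m 0 = 0 := by
    rw [hm]
    exact setIntegral_eq_zero_of_forall_eq_zero fun x hx => (hq x hx).2.2.1
  have hmn : ∀ k, 0 ≤ m k := fun k => setIntegral_nonneg hdm fun x hx => (hq x hx).2.1 k
  have hvol : ∀ t : ℝ, 0 < t →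
      (volume (A + t • Metric.closedBall (0 : EuclideanSpace ℝ (Fin d)) 1)).toReal =
        (volume A).toReal + ∑ k ∈ Finset.range (d + 1), m k * t ^ k := by
    intro t ht
    have h1 := hfin t
    rw [h.volume_parallel hA ht] at h1 ⊢
    obtain ⟨h2, h3⟩ := ENNReal.add_ne_top.1 h1
    rw [ENNReal.toReal_add h2 h3]
    congr 1
    have h4 : ∀ x ∈ dom A p, |(jac p t x).det| =
        ∑ k ∈ Finset.range (d + 1), (q x).coeff k * t ^ k := by
      intro x hx
      obtain ⟨e1, e2, -, e3⟩ := hq x hx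
      rw [← e3, eval_eq_sum_range' (Nat.lt_succ_of_le e1), abs_of_nonneg]
      exact Finset.sum_nonneg fun k _ => mul_nonneg (e2 k) (by positivity)
    rw [← integral_eq_lintegral_of_nonneg_ae (Filter.Eventually.of_forall fun x => abs_nonneg _)
      (hdet t).abs.aestronglyMeasurable, setIntegral_congr_fun hdm h4,
      integral_finsetSum _ fun k _ => (hcint k).mul_const _]
    simp only [integral_mul_const, hm]
  refine ⟨fun i => m (d - i) + if i = Fin.last d then (volume A).toReal else 0, ?_, ?_, ?_⟩
  · intro i
    have := hmn (d - i)
    dsimp only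
    split_ifs <;> positivity
  · simp [hm0]
  · intro t ht
    have hsum : ∑ i : Fin (d + 1), (m (d - i) + if i = Fin.last d then (volume A).toReal else 0)
        * t ^ (d - (i : ℕ)) = (volume A).toReal + ∑ k ∈ Finset.range (d + 1), m k * t ^ k := by
      simp only [add_mul, Finset.sum_add_distrib, ite_mul, zero_mul, Finset.sum_ite_eq',
        Finset.mem_univ, if_true, Fin.val_last, Nat.sub_self, pow_zero, mul_one]
      rw [add_comm, Fin.sum_univ_eq_sum_range (fun i => m (d - i) * t ^ (d - i)),
        ← Finset.sum_range_reflect (fun k => m k * t ^ k)]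
      simp
    rw [hsum]
    rcases ht.eq_or_lt with rfl | ht
    · rw [Finset.sum_range_succ', Finset.sum_eq_zero (by simp)]
      rw [Set.zero_smul_set ⟨0, by simp⟩]
      simp [hm0]
    · exact hvol t ht

end SteinerProj


/-- **Steiner's formula.** Let `A ⊆ ℝ^d` be a nonempty compact convex
set and `B^d` the closed unit ball.  Then there exist nonnegative reals
`c_0, …, c_d`, with `c_d = vol_d(A)`, such that for every `ε ≥ 0`,
`vol_d(A + εB^d) = ∑_{i=0}^{d} c_i ε^{d−i}`. -/
theorem stmt_11 (d : ℕ) (A : Set (EuclideanSpace ℝ (Fin d)))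
    (hAne : A.Nonempty) (hAc : IsCompact A) (hAconv : Convex ℝ A) :
    ∃ c : Fin (d + 1) → ℝ,
      (∀ i, 0 ≤ c i) ∧
      c (Fin.last d) = (volume A).toReal ∧
      ∀ ε : ℝ, 0 ≤ ε →
        (volume (A + ε • Metric.closedBall (0 : EuclideanSpace ℝ (Fin d)) 1)).toReal
          = ∑ i : Fin (d + 1), c i * ε ^ (d - (i : ℕ)) := by
  have hp : ∀ x, ∃ y ∈ A, ∀ w ∈ A, inner ℝ (x - y) (w - y) ≤ 0 := by
    intro x
    obtain ⟨y, hy, hxy⟩ := exists_norm_eq_iInf_of_complete_convex hAne hAc.isComplete hAconv x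
    exact ⟨y, hy, (norm_eq_iInf_iff_real_inner_le_zero hAconv hy).1 hxy⟩
  choose p hp1 hp2 using hp
  exact SteinerProj.main ⟨hp1, hp2⟩ hAc
end
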